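/- arXiv:1711.10764 — 12 statements merged into one kernel-verified Lean document; each statement's English description precedes it below -/
import Mathlib

section
/- Let q be a prime power and let (u_n) be a q-automatic sequence over F_q which is not ultimately periodic (equivalently, its generating function G(t) is not a rational function). Suppose h(s,t) = h_0(t) + h_1(t)s + … + h_d(t)s^d ∈ F_q[s,t] is a nonzero polynomial with h_d ≠ 0, d ≥ 1, such that h(G(t),t) = 0 and such that h(s,t), viewed as a polynomial in s, has no zero in the rational function field F_q(t). Put M = max_{0 ≤ i ≤ d}(deg h_i − i). Then for every N ≥ 1, (N − M)/d ≤ L(u_n,N) ≤ ((d−1)N + M + 1)/d. -/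
/-- The N-th linear complexity of a sequence over a field: the least length `L` of a
linear recurrence satisfied by the first `N` terms of the sequence. -/
noncomputable def linearComplexity {F : Type*} [Field F] (u : ℕ → F) (N : ℕ) : ℕ :=
  sInf {L | ∃ c : Fin L → F, ∀ n, n + L < N → u (n + L) = ∑ i, c i * u (n + i)}

open Polynomial

section Functional

variable {F : Type*} [Field F]

/-- The linear functional on polynomials sending `X ^ n` to `u n`. -/
noncomputable def momentFunctional (u : ℕ → F) : F[X] →ₗ[F] F :=
  (Polynomial.basisMonomials F).constr F u

lemma momentFunctional_X_pow (u : ℕ → F) (n : ℕ) : momentFunctional u (X ^ n) = u n := by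
  have := (Polynomial.basisMonomials F).constr_basis F u n
  rw [Polynomial.coe_basisMonomials] at this
  rwa [← Polynomial.monomial_one_right_eq_X_pow]

lemma momentFunctional_C_mul (u : ℕ → F) (a : F) (p : F[X]) :
    momentFunctional u (C a * p) = a * momentFunctional u p := by
  rw [← Polynomial.smul_eq_C_mul, map_smul, smul_eq_mul]

lemma momentFunctional_X_pow_mul_sum_fin (u : ℕ → F) {k : ℕ} (c : Fin k → F) (j : ℕ) :
    momentFunctional u (X ^ j * ∑ i, C (c i) * X ^ (i : ℕ)) = ∑ i, c i * u (j + i) := by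
  rw [Finset.mul_sum, map_sum]
  refine Finset.sum_congr rfl fun i _ => ?_
  rw [mul_left_comm, ← pow_add, momentFunctional_C_mul, momentFunctional_X_pow]

lemma momentFunctional_mul_eq_zero (u : ℕ → F) {k : ℕ} {E : F[X]}
    (hE : ∀ n < k, momentFunctional u (X ^ n * E) = 0) {Q : F[X]} (hQ : Q.natDegree < k) :
    momentFunctional u (Q * E) = 0 := by
  rw [Q.as_sum_range_C_mul_X_pow, Finset.sum_mul, map_sum]
  refine Finset.sum_eq_zero fun i hi => ?_
  rw [mul_assoc, momentFunctional_C_mul, hE i (by rw [Finset.mem_range] at hi; omega), mul_zero]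

lemma momentFunctional_monic_mul (u : ℕ → F) {m : ℕ} {E : F[X]}
    (hE : ∀ n < m, momentFunctional u (X ^ n * E) = 0) {Q : F[X]} (hQ : Q.Monic)
    (hm : Q.natDegree = m) :
    momentFunctional u (Q * E) = momentFunctional u (X ^ m * E) := by
  rw [hQ.as_sum, hm, add_mul, map_add, Finset.sum_mul, map_sum, add_eq_left]
  refine Finset.sum_eq_zero fun i hi => ?_
  rw [mul_assoc, momentFunctional_C_mul, hE i (Finset.mem_range.1 hi), mul_zero]

lemma linearComplexity_spec (u : ℕ → F) (N : ℕ) :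
    ∃ c : Fin (linearComplexity u N) → F, ∀ n, n + linearComplexity u N < N →
      u (n + linearComplexity u N) = ∑ i, c i * u (n + i) :=
  Nat.sInf_mem (s := {L | ∃ c : Fin L → F, ∀ n, n + L < N → u (n + L) = ∑ i, c i * u (n + i)})
    ⟨N, 0, fun n hn => by omega⟩

lemma linearComplexity_zero (u : ℕ → F) : linearComplexity u 0 = 0 :=
  Nat.le_zero.1 (Nat.sInf_le ⟨0, fun n hn => by omega⟩)

/-- The linear complexity is realized by a monic annihilating polynomial. -/
lemma exists_monic_annihilator (u : ℕ → F) (N : ℕ) :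
    ∃ P : F[X], P.Monic ∧ P.natDegree = linearComplexity u N ∧
      ∀ n < N - linearComplexity u N, momentFunctional u (X ^ n * P) = 0 := by
  obtain ⟨c, hc⟩ := linearComplexity_spec u N
  have hdeg := Polynomial.degree_sum_fin_lt c
  have hmonic := Polynomial.monic_X_pow_sub hdeg
  refine ⟨X ^ linearComplexity u N - ∑ i, C (c i) * X ^ (i : ℕ), hmonic, ?_, fun n hn => ?_⟩
  · refine Polynomial.natDegree_eq_of_degree_eq_some ?_
    rw [Polynomial.degree_sub_eq_left_of_degree_lt (by rwa [Polynomial.degree_X_pow]),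
      Polynomial.degree_X_pow]
  · rw [mul_sub, map_sub, momentFunctional_X_pow_mul_sum_fin, ← pow_add, momentFunctional_X_pow,
      hc n (by omega), sub_self]

/-- Any nonzero annihilating polynomial bounds the linear complexity by its degree. -/
lemma linearComplexity_le_natDegree (u : ℕ → F) {N : ℕ} {E : F[X]} (hE0 : E ≠ 0)
    (hE : ∀ n, n + E.natDegree < N → momentFunctional u (X ^ n * E) = 0) :
    linearComplexity u N ≤ E.natDegree := by
  refine Nat.sInf_le ⟨fun i => -(E.leadingCoeff⁻¹ * E.coeff i), fun n hn => ?_⟩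
  have h := hE n hn
  have hl : E.leadingCoeff ≠ 0 := Polynomial.leadingCoeff_ne_zero.2 hE0
  have hsum : momentFunctional u (X ^ n * E)
      = ∑ i ∈ Finset.range (E.natDegree + 1), E.coeff i * u (n + i) := by
    conv_lhs => rw [E.as_sum_range_C_mul_X_pow]
    rw [Finset.mul_sum, map_sum]
    refine Finset.sum_congr rfl fun i _ => ?_
    rw [mul_left_comm, ← pow_add, momentFunctional_C_mul, momentFunctional_X_pow]
  rw [hsum, Finset.sum_range_succ, Polynomial.coeff_natDegree, Finset.sum_range] at h
  simp only [neg_mul, mul_assoc, Finset.sum_neg_distrib, ← Finset.mul_sum]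
  field_simp
  linear_combination h

/-- One more term raises the linear complexity `L` to at most `max L (N + 1 - L)`. -/
lemma linearComplexity_succ_le (u : ℕ → F) (N : ℕ) :
    linearComplexity u (N + 1) ≤ max (linearComplexity u N) (N + 1 - linearComplexity u N) := by
  obtain ⟨P, hP, hPdeg, hPann⟩ := exists_monic_annihilator u N
  set L := linearComplexity u N with hL
  set m := max L (N + 1 - L) with hm
  have hmL : L ≤ m := le_max_left _ _
  have hmN : N + 1 - L ≤ m := le_max_right _ _
  set b : Fin (N + 1 - m) → F := fun n => u (n + m) with hb
  set V : Fin m → Fin (N + 1 - m) → F := fun i n => u (n + i) with hV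
  suffices hmem : b ∈ Submodule.span F (Set.range V) by
    obtain ⟨c, hc⟩ := (Submodule.mem_span_range_iff_exists_fun F).1 hmem
    refine Nat.sInf_le ⟨c, fun n hn => ?_⟩
    have := congrFun hc ⟨n, by omega⟩
    simpa [hb, hV] using this.symm
  by_contra hmem
  obtain ⟨f, hfb, hfV⟩ := Submodule.exists_dual_map_eq_bot_of_notMem hmem inferInstance
  set e : Fin (N + 1 - m) → F := fun n => f fun j => if n = j then 1 else 0 with he
  set E : F[X] := ∑ n, C (e n) * X ^ (n : ℕ) with hE
  have hφ : ∀ j, momentFunctional u (X ^ j * E) = f fun n => u (n + j) := by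
    intro j
    rw [hE, momentFunctional_X_pow_mul_sum_fin, LinearMap.pi_apply_eq_sum_univ f]
    refine Finset.sum_congr rfl fun i _ => ?_
    rw [smul_eq_mul, mul_comm, add_comm]
  have hEann : ∀ j < m, momentFunctional u (X ^ j * E) = 0 := by
    intro j hj
    rw [hφ, ← Submodule.mem_bot F, ← hfV]
    exact Submodule.mem_map_of_mem (Submodule.subset_span ⟨⟨j, hj⟩, rfl⟩)
  have hEm : momentFunctional u (X ^ m * E) ≠ 0 := by rwa [hφ]
  have hE0 : E ≠ 0 := by
    intro h0
    simp [h0] at hEm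
  have hEdeg : E.natDegree < N + 1 - m :=
    (Polynomial.natDegree_lt_iff_degree_lt hE0).2 (Polynomial.degree_sum_fin_lt e)
  by_cases hcase : E.natDegree + m < N
  · have hQ : (X ^ (m - L) * P).natDegree = m := by
      rw [Polynomial.Monic.natDegree_mul (Polynomial.monic_X_pow _) hP, Polynomial.natDegree_X_pow]
      omega
    apply hEm
    rw [← momentFunctional_monic_mul u hEann ((Polynomial.monic_X_pow (m - L)).mul hP) hQ,
      mul_right_comm]
    refine momentFunctional_mul_eq_zero u hPann ?_
    rw [Polynomial.natDegree_mul (Polynomial.monic_X_pow _).ne_zero hE0,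
      Polynomial.natDegree_X_pow]
    omega
  · have := linearComplexity_le_natDegree u (N := N) hE0 fun n hn => hEann n (by omega)
    omega

end Functional

section RationalApproximation

variable {F : Type*} [Field F]

/-- A sequence of linear complexity `L` is approximated by a fraction `f / g` with
`deg g ≤ L` and `deg f < L`. -/
lemma exists_rational_approximation (u : ℕ → F) (N : ℕ) :
    ∃ f g : F[X], g ≠ 0 ∧ g.natDegree ≤ linearComplexity u N ∧
      f.degree < linearComplexity u N ∧
      (PowerSeries.X : PowerSeries F) ^ N ∣ (g : PowerSeries F) * PowerSeries.mk u - f := by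
  have hspec := linearComplexity_spec u N
  generalize linearComplexity u N = L at hspec ⊢
  obtain ⟨c, hc⟩ := hspec
  set g : F[X] := 1 - ∑ i : Fin L, C (c i) * X ^ (L - (i : ℕ)) with hg
  refine ⟨PowerSeries.trunc L ((g : PowerSeries F) * PowerSeries.mk u), g, ?_, ?_,
    PowerSeries.degree_trunc_lt _ _, ?_⟩
  · intro h0
    have h1 : g.coeff 0 = 1 := by
      rw [hg, Polynomial.coeff_sub, Polynomial.coeff_one_zero, Polynomial.finsetSum_coeff,
        Finset.sum_eq_zero, sub_zero]
      intro i _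
      rw [Polynomial.coeff_C_mul_X_pow, if_neg (by omega)]
    simp [h0] at h1
  · refine (Polynomial.natDegree_sub_le _ _).trans (max_le (by simp) ?_)
    refine Polynomial.natDegree_sum_le_of_forall_le _ _ fun i _ => ?_
    exact (Polynomial.natDegree_C_mul_X_pow_le _ _).trans (Nat.sub_le _ _)
  · rw [PowerSeries.X_pow_dvd_iff]
    intro k hk
    rw [map_sub, Polynomial.coeff_coe, PowerSeries.coeff_trunc]
    split_ifs with hkL
    · exact sub_self _
    · obtain ⟨n, rfl⟩ := Nat.exists_eq_add_of_le' (not_lt.1 hkL)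
      have hgG : (g : PowerSeries F) * PowerSeries.mk u = PowerSeries.mk u
          - ∑ i : Fin L, PowerSeries.C (c i) *
            (PowerSeries.X ^ (L - (i : ℕ)) * PowerSeries.mk u) := by
        have : (g : PowerSeries F) = 1 - ∑ i : Fin L, PowerSeries.C (c i) *
            PowerSeries.X ^ (L - (i : ℕ)) := by
          rw [← Polynomial.coeToPowerSeries.ringHom_apply, hg, map_sub, map_sum]
          simp
        rw [this, sub_mul, one_mul, Finset.sum_mul]
        simp only [mul_assoc]
      rw [sub_zero, hgG, map_sub, PowerSeries.coeff_mk, hc n hk, map_sum, sub_eq_zero]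
      refine Finset.sum_congr rfl fun i _ => ?_
      rw [PowerSeries.coeff_C_mul, PowerSeries.coeff_X_pow_mul',
        if_pos (show L - (i : ℕ) ≤ n + L by omega), PowerSeries.coeff_mk]
      congr 2
      omega

/-- Substituting the approximation into the algebraic equation bounds its quality. -/
lemma le_add_mul_linearComplexity (u : ℕ → F) (d : ℕ) (h : ℕ → F[X])
    (hroot : ∑ i ∈ Finset.range (d + 1), (h i : PowerSeries F) * PowerSeries.mk u ^ i = 0)
    (hnorat : ∀ r : RatFunc F,
      ∑ i ∈ Finset.range (d + 1), algebraMap F[X] (RatFunc F) (h i) * r ^ i ≠ 0)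
    (M : ℤ) (hM : ∀ i ≤ d, h i ≠ 0 → ((h i).natDegree : ℤ) - i ≤ M) (N : ℕ) :
    (N : ℤ) ≤ M + d * linearComplexity u N := by
  obtain ⟨f, g, hg0, hg, hf, hdvd⟩ := exists_rational_approximation u N
  set L := linearComplexity u N with hL
  set P : F[X] := ∑ i ∈ Finset.range (d + 1), h i * f ^ i * g ^ (d - i) with hP
  have hP0 : P ≠ 0 := by
    intro h0
    have hg' : algebraMap F[X] (RatFunc F) g ≠ 0 := by
      simpa using hg0
    have hmap := congrArg (algebraMap F[X] (RatFunc F)) h0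
    rw [hP, map_sum, map_zero] at hmap
    refine hnorat (algebraMap F[X] (RatFunc F) f / algebraMap F[X] (RatFunc F) g) ?_
    refine (mul_eq_zero.1 (?_ : algebraMap F[X] (RatFunc F) g ^ d * _ = 0)).resolve_left
      (pow_ne_zero _ hg')
    rw [← hmap, Finset.mul_sum]
    refine Finset.sum_congr rfl fun i hi => ?_
    have hid : d = (d - i) + i := by rw [Finset.mem_range] at hi; omega
    conv_lhs => rw [hid]
    rw [map_mul, map_mul, map_pow, map_pow, pow_add, div_pow]
    field_simp
  have hPdvd : (PowerSeries.X : PowerSeries F) ^ N ∣ (P : PowerSeries F) := by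
    have hcast : (P : PowerSeries F) = ∑ i ∈ Finset.range (d + 1),
        (h i : PowerSeries F) * (f : PowerSeries F) ^ i * (g : PowerSeries F) ^ (d - i) := by
      rw [← Polynomial.coeToPowerSeries.ringHom_apply, hP, map_sum]
      simp
    have hdiff : (P : PowerSeries F) = -∑ i ∈ Finset.range (d + 1),
        (h i : PowerSeries F) * (g : PowerSeries F) ^ (d - i) *
          (((g : PowerSeries F) * PowerSeries.mk u) ^ i - (f : PowerSeries F) ^ i) := by
      have hzero : ∑ i ∈ Finset.range (d + 1), (h i : PowerSeries F) *
          (g : PowerSeries F) ^ (d - i) * ((g : PowerSeries F) * PowerSeries.mk u) ^ i = 0 := by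
        rw [← mul_zero ((g : PowerSeries F) ^ d), ← hroot, Finset.mul_sum]
        refine Finset.sum_congr rfl fun i hi => ?_
        have hid : d = (d - i) + i := by rw [Finset.mem_range] at hi; omega
        conv_rhs => rw [hid]
        ring
      simp only [mul_sub, Finset.sum_sub_distrib]
      rw [hzero, zero_sub, neg_neg, hcast]
      exact Finset.sum_congr rfl fun i _ => by ring
    rw [hdiff, dvd_neg]
    exact Finset.dvd_sum fun i _ => ((hdvd.trans (sub_dvd_pow_sub_pow _ _ i))).mul_left _
  have hlead : P.coeff P.natDegree ≠ 0 := by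
    rwa [Polynomial.coeff_natDegree, Polynomial.leadingCoeff_ne_zero]
  have hNP : N ≤ P.natDegree := by
    by_contra hlt
    refine hlead ?_
    rw [← Polynomial.coeff_coe]
    exact PowerSeries.X_pow_dvd_iff.1 hPdvd _ (not_le.1 hlt)
  have hsum : ∑ i ∈ Finset.range (d + 1), (h i * f ^ i * g ^ (d - i)).coeff P.natDegree ≠ 0 := by
    rwa [← Polynomial.finsetSum_coeff]
  obtain ⟨i, hi, hcoeff⟩ := Finset.exists_ne_zero_of_sum_ne_zero hsum
  have hid : i ≤ d := Nat.lt_succ_iff.1 (Finset.mem_range.1 hi)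
  have hle := Polynomial.le_natDegree_of_ne_zero hcoeff
  have hterm : h i * f ^ i * g ^ (d - i) ≠ 0 := by
    intro h0
    simp [h0] at hcoeff
  have hhi : h i ≠ 0 := left_ne_zero_of_mul (left_ne_zero_of_mul hterm)
  have hfi : f ^ i ≠ 0 := right_ne_zero_of_mul (left_ne_zero_of_mul hterm)
  rw [Polynomial.natDegree_mul (mul_ne_zero hhi hfi) (pow_ne_zero _ hg0),
    Polynomial.natDegree_mul hhi hfi, Polynomial.natDegree_pow, Polynomial.natDegree_pow] at hle
  have hfdeg : (i : ℤ) * f.natDegree ≤ i * ((L : ℤ) - 1) := by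
    rcases Nat.eq_zero_or_pos i with rfl | hipos
    · simp
    · have hf0 : f ≠ 0 := fun h0 => hfi (by rw [h0, zero_pow hipos.ne'])
      have := (Polynomial.natDegree_lt_iff_degree_lt hf0).2 hf
      exact mul_le_mul_of_nonneg_left (by omega) (by positivity)
  have hgdeg : ((d - i : ℕ) : ℤ) * g.natDegree ≤ ((d : ℤ) - i) * L := by
    rw [Nat.cast_sub hid]
    exact mul_le_mul_of_nonneg_left (by exact_mod_cast hg) (by omega)
  have hMi := hM i hid hhi
  have hle' : (N : ℤ) ≤ (h i).natDegree + i * f.natDegree + ((d - i : ℕ) : ℤ) * g.natDegree := by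
    exact_mod_cast hNP.trans hle
  linarith

end RationalApproximation

/-- A linear lower bound on the linear complexity profile forces a linear upper bound. -/
lemma mul_linearComplexity_le {F : Type*} [Field F] (u : ℕ → F) {d : ℕ} (hd : 1 ≤ d) {M : ℤ}
    (hlow : ∀ N : ℕ, (N : ℤ) ≤ M + d * linearComplexity u N) (N : ℕ) :
    (d : ℤ) * linearComplexity u N ≤ (d - 1) * N + M + 1 := by
  induction N with
  | zero =>
    have := hlow 0
    rw [linearComplexity_zero] at this ⊢
    push_cast at this ⊢
    linarith
  | succ N ih =>
    have hlowN := hlow N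
    have hd' : (0 : ℤ) ≤ (d : ℤ) - 1 := by omega
    push_cast
    by_cases hcase : linearComplexity u (N + 1) ≤ linearComplexity u N
    · have : (d : ℤ) * linearComplexity u (N + 1) ≤ d * linearComplexity u N :=
        mul_le_mul_of_nonneg_left (by exact_mod_cast hcase) (by positivity)
      linarith
    · have hjump := linearComplexity_succ_le u N
      have hle : (linearComplexity u (N + 1) : ℤ) ≤ N + 1 - linearComplexity u N := by omega
      have : (d : ℤ) * linearComplexity u (N + 1) ≤ d * (N + 1 - linearComplexity u N) :=
        mul_le_mul_of_nonneg_left hle (by positivity)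
      linarith

/-- Theorem 1 of the paper: if `u` is a `q`-automatic sequence over `F_q` (equivalently,
its generating function `G` is algebraic, being a root of `h(s,t) = ∑ h_i(t) sⁱ`) which is
not ultimately periodic (equivalently, `G` is not rational), and `h` has no rational zero,
then `(N - M)/d ≤ L(u,N) ≤ ((d-1)N + M + 1)/d`, where `M = max_{0 ≤ i ≤ d} (deg h_i - i)`. -/
theorem automatic_linearComplexity_bounds {F : Type*} [Field F] [Fintype F]
    (u : ℕ → F) (G : PowerSeries F) (hG : G = PowerSeries.mk u)
    (hirr : ¬ ∃ f g : Polynomial F, g ≠ 0 ∧ (g : PowerSeries F) * G = (f : PowerSeries F))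
    (d : ℕ) (hd : 1 ≤ d) (h : ℕ → Polynomial F) (hhd : h d ≠ 0)
    (hhtop : ∀ i, d < i → h i = 0)
    (hroot : ∑ i ∈ Finset.range (d + 1), (h i : PowerSeries F) * G ^ i = 0)
    (hnorat : ∀ r : RatFunc F,
      ∑ i ∈ Finset.range (d + 1), algebraMap (Polynomial F) (RatFunc F) (h i) * r ^ i ≠ 0)
    (M : ℤ)
    (hM1 : ∀ i ≤ d, h i ≠ 0 → ((h i).natDegree : ℤ) - i ≤ M)
    (hM2 : ∃ i ≤ d, h i ≠ 0 ∧ ((h i).natDegree : ℤ) - i = M)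
    (N : ℕ) (hN : 1 ≤ N) :
    ((N : ℚ) - (M : ℚ)) / d ≤ (linearComplexity u N : ℚ) ∧
      (linearComplexity u N : ℚ) ≤ (((d : ℚ) - 1) * N + (M : ℚ) + 1) / d := by
  subst hG
  have hlow := le_add_mul_linearComplexity u d h hroot hnorat M hM1
  have hd0 : (0 : ℚ) < d := by exact_mod_cast hd
  constructor
  · rw [div_le_iff₀ hd0]
    have : (N : ℚ) ≤ M + d * linearComplexity u N := by exact_mod_cast hlow N
    linarith
  · rw [le_div_iff₀ hd0]
    have : (d : ℚ) * linearComplexity u N ≤ (d - 1) * N + M + 1 := by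
      exact_mod_cast mul_linearComplexity_le u hd hlow N
    linarith
end

section
/- Let p be a prime and let (s_n) be the sum-of-digits sequence modulo p, i.e. s_n ∈ F_p is the sum of the base-p digits of n reduced modulo p. Then for every N ≥ 1, (N − 1)/p ≤ L(s_n,N) ≤ ((p−1)N + 2)/p. -/
namespace LinearComplexity

variable {F : Type*} [Field F]

theorem self_mem_recurrence_lengths (u : ℕ → F) (N : ℕ) :
    N ∈ {L | ∃ c : Fin L → F, ∀ n, n + L < N → u (n + L) = ∑ i, c i * u (n + i)} :=
  ⟨0, fun n h => by omega⟩

theorem le_self (u : ℕ → F) (N : ℕ) : linearComplexity u N ≤ N :=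
  Nat.sInf_le (self_mem_recurrence_lengths u N)

theorem exists_recurrence (u : ℕ → F) (N : ℕ) :
    ∃ c : Fin (linearComplexity u N) → F, ∀ n, n + linearComplexity u N < N →
      u (n + linearComplexity u N) = ∑ i, c i * u (n + i) :=
  Nat.sInf_mem (s := {L | ∃ c : Fin L → F, ∀ n, n + L < N → u (n + L) = ∑ i, c i * u (n + i)})
    ⟨N, self_mem_recurrence_lengths u N⟩

theorem le_of_recurrence {u : ℕ → F} {N L : ℕ} (c : Fin L → F)
    (h : ∀ n, n + L < N → u (n + L) = ∑ i, c i * u (n + i)) : linearComplexity u N ≤ L :=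
  Nat.sInf_le ⟨c, h⟩

/-- A vanishing linear combination of shifts of `u` with nonzero top coefficient bounds the
linear complexity. -/
theorem le_of_combination {u : ℕ → F} {N l : ℕ} (d : ℕ → F) (hl : d l ≠ 0)
    (h : ∀ n, n + l < N → ∑ j ∈ Finset.range (l + 1), d j * u (n + j) = 0) :
    linearComplexity u N ≤ l := by
  refine le_of_recurrence (fun i => -(d l)⁻¹ * d i) fun n hn => ?_
  have h1 := h n hn
  rw [Finset.sum_range_succ, Finset.sum_range] at h1
  simp_rw [mul_assoc, ← Finset.mul_sum]
  rw [eq_neg_of_add_eq_zero_left h1]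
  field_simp

/-- If a combination of shifts of `u` vanishes on the first `linearComplexity u N` positions,
then it vanishes as long as the recurrence of `u` controls it. -/
theorem combination_eq_zero {u : ℕ → F} {N l : ℕ} (d : ℕ → F)
    (h : ∀ n, n < linearComplexity u N →
      ∑ j ∈ Finset.range (l + 1), d j * u (n + j) = 0) :
    ∀ n, n + l < N → ∑ j ∈ Finset.range (l + 1), d j * u (n + j) = 0 := by
  obtain ⟨c, hc⟩ := exists_recurrence u N
  generalize linearComplexity u N = L at *
  intro n
  induction n using Nat.strong_induction_on with
  | _ n ih =>
    intro hn
    by_cases hnL : n < L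
    · exact h n hnL
    obtain ⟨m, rfl⟩ := Nat.exists_eq_add_of_le' (not_lt.mp hnL)
    have key : ∀ j ∈ Finset.range (l + 1),
        d j * u (m + L + j) = ∑ i, c i * (d j * u (m + i + j)) := by
      intro j hj
      rw [Finset.mem_range] at hj
      rw [show m + L + j = m + j + L by ring, hc _ (by omega), Finset.mul_sum]
      refine Finset.sum_congr rfl fun i _ => ?_
      rw [show m + j + (i : ℕ) = m + i + j by ring]
      ring
    rw [Finset.sum_congr rfl key, Finset.sum_comm]
    refine Finset.sum_eq_zero fun i _ => ?_
    rw [← Finset.mul_sum, ih (m + i) (by omega) (by omega), mul_zero]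

theorem mulVec_surjective_of_linearIndependent_row {m n : Type*} [Fintype m] [Fintype n]
    {A : Matrix m n F} (h : LinearIndependent F A.row) : Function.Surjective A.mulVec := by
  have hr := h.rank_matrix
  have ht : LinearMap.range A.mulVecLin = ⊤ := by
    apply Submodule.eq_top_of_finrank_eq
    rw [Module.finrank_fintype_fun_eq_card]
    exact hr
  exact LinearMap.range_eq_top.mp ht

/-- Massey's bound for the growth of the linear complexity. -/
theorem succ_le (u : ℕ → F) (N : ℕ) :
    linearComplexity u (N + 1) ≤ max (linearComplexity u N) (N + 1 - linearComplexity u N) := by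
  have hLN := le_self u N
  set L := linearComplexity u N with hL
  set K := max L (N + 1 - L) with hK
  have hKL : L ≤ K := le_max_left _ _
  have hKN : N + 1 - L ≤ K := le_max_right _ _
  let A : Matrix (Fin (N + 1 - K)) (Fin K) F := Matrix.of fun j i => u (j + i)
  have hA : LinearIndependent F A.row := by
    rw [Fintype.linearIndependent_iff]
    intro g hg
    by_contra! hne
    let d : ℕ → F := fun j => if hj : j < N + 1 - K then g ⟨j, hj⟩ else 0
    obtain ⟨l, hgl, hmax⟩ :=
      Set.exists_max_image {j | g j ≠ 0} id (Set.toFinite _) hne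
    have htop : ∀ j, l < j → g j = 0 := fun j hj => by
      by_contra hgj
      exact absurd hj (not_lt.mpr (hmax j hgj))
    have hsum : ∀ n, n < K → ∑ j ∈ Finset.range ((l : ℕ) + 1), d j * u (n + j) = 0 := by
      intro n hn
      have h1 := congrFun hg ⟨n, hn⟩
      simp only [Finset.sum_apply, Pi.smul_apply, smul_eq_mul, Matrix.row, Matrix.of_apply,
        Pi.zero_apply, A] at h1
      rw [← h1]
      have h2 : ∑ j : Fin (N + 1 - K), g j * u (j + n)
          = ∑ j ∈ Finset.range (N + 1 - K), d j * u (n + j) := by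
        rw [Finset.sum_range]
        refine Finset.sum_congr rfl fun j _ => ?_
        simp [d, add_comm]
      rw [h2]
      refine Finset.sum_subset (Finset.range_mono (by omega)) fun j hj hj' => ?_
      rw [Finset.mem_range] at hj hj'
      simp only [d, dif_pos hj]
      rw [htop ⟨j, hj⟩ (by rw [Fin.lt_def]; simp; omega), zero_mul]
    have hle : L ≤ l := le_of_combination d (by simpa [d] using hgl)
      (combination_eq_zero d fun n hn => hsum n (lt_of_lt_of_le hn hKL))
    omega
  obtain ⟨c, hc⟩ := mulVec_surjective_of_linearIndependent_row hA fun j => u (j + K)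
  refine le_of_recurrence c fun n hn => ?_
  have := congrFun hc ⟨n, by omega⟩
  simp only [Matrix.mulVec, dotProduct, A, Matrix.of_apply] at this
  rw [← this]
  exact Finset.sum_congr rfl fun i _ => mul_comm _ _

/-- The generating function of `u` is, up to order `N`, a rational function whose denominator
has degree at most the linear complexity. -/
theorem exists_denominator (u : ℕ → F) (N : ℕ) :
    ∃ Q : Polynomial F, Q ≠ 0 ∧ Q.natDegree ≤ linearComplexity u N ∧
      ∀ n, linearComplexity u N ≤ n → n < N →
        PowerSeries.coeff n ((Q : PowerSeries F) * PowerSeries.mk u) = 0 := by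
  obtain ⟨c, hc⟩ := exists_recurrence u N
  generalize linearComplexity u N = L at *
  let d : ℕ → F := fun k =>
    if k = 0 then 1 else if hk : L - k < L then -c ⟨L - k, hk⟩ else 0
  let Q : Polynomial F := ∑ k ∈ Finset.range (L + 1), Polynomial.monomial k (d k)
  have hcoeff : ∀ k, Q.coeff k = if k < L + 1 then d k else 0 := by
    intro k
    simp [Q, Polynomial.coeff_monomial]
  refine ⟨Q, fun h0 => ?_, ?_, fun n hn hnN => ?_⟩
  · have := hcoeff 0
    simp [h0, d] at this
  · refine Polynomial.natDegree_le_iff_coeff_eq_zero.mpr fun k hk => ?_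
    rw [hcoeff, if_neg (by omega)]
  · obtain ⟨m, rfl⟩ := Nat.exists_eq_add_of_le' hn
    rw [PowerSeries.coeff_mul, Finset.Nat.sum_antidiagonal_eq_sum_range_succ
      (fun i j => PowerSeries.coeff i (Q : PowerSeries F) * PowerSeries.coeff j
        (PowerSeries.mk u))]
    simp only [Polynomial.coeff_coe, PowerSeries.coeff_mk]
    have h1 : ∑ k ∈ Finset.range (m + L).succ, Q.coeff k * u (m + L - k)
        = ∑ k ∈ Finset.range (L + 1), d k * u (m + L - k) := by
      symm
      refine Finset.sum_subset_zero_on_sdiff (Finset.range_mono (by omega)) ?_ ?_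
      · intro k hk
        simp only [Finset.mem_sdiff, Finset.mem_range] at hk
        rw [hcoeff, if_neg hk.2, zero_mul]
      · intro k hk
        rw [hcoeff, if_pos (Finset.mem_range.mp hk)]
    rw [h1, Finset.sum_range_succ', ← Finset.sum_range_reflect, Finset.sum_range]
    have h2 : ∀ i : Fin L, d (L - 1 - i + 1) * u (m + L - (L - 1 - i + 1))
        = -(c i * u (m + i)) := by
      intro i
      have hi := i.2
      have e1 : L - 1 - (i : ℕ) + 1 = L - i := by omega
      have e2 : m + L - (L - (i : ℕ)) = m + i := by omega
      have e3 : L - (L - (i : ℕ)) = i := by omega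
      rw [e1, e2]
      simp only [d, e3]
      rw [if_neg (by omega), dif_pos hi, neg_mul]
    rw [Finset.sum_congr rfl fun i _ => h2 i, Finset.sum_neg_distrib, ← hc m hnN]
    simp [d]

end LinearComplexity

section ArtinSchreier

open Polynomial

/-- The equation `y - y ^ (k + 2) = X / (1 - X)` has no rational solution `y = A / Q` in lowest
terms. -/
theorem one_sub_X_mul_ne_of_isCoprime {F : Type*} [Field F] {k : ℕ} {A Q : F[X]}
    (hco : IsCoprime A Q) :
    (1 - X) * (Q ^ (k + 1) * A - A ^ (k + 2)) ≠ X * Q ^ (k + 2) := by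
  intro h
  have hprime : Prime (1 - X : F[X]) := by
    have := (prime_X_sub_C (1 : F)).neg
    simpa using this
  have hX : ¬ (1 - X : F[X]) ∣ X := fun hd => hprime.not_isUnit <|
    isUnit_of_dvd_one <| by simpa using dvd_add (dvd_refl (1 - X : F[X])) hd
  have hQ : (1 - X : F[X]) ∣ Q := by
    have : (1 - X : F[X]) ∣ X * Q ^ (k + 2) := h ▸ dvd_mul_right _ _
    exact hprime.dvd_of_dvd_pow ((hprime.dvd_or_dvd this).resolve_left hX)
  obtain ⟨R, rfl⟩ := hQ
  have h2 : ((1 - X) * R) ^ (k + 1) * A - A ^ (k + 2) =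
      (1 - X) * (X * ((1 - X) ^ k * R ^ (k + 2))) := by
    refine mul_left_cancel₀ hprime.ne_zero ?_
    rw [h, mul_pow]
    ring
  have hA : (1 - X : F[X]) ∣ A := by
    refine hprime.dvd_of_dvd_pow (n := k + 2) ?_
    refine (dvd_sub_right (a := (1 - X : F[X])) (b := ((1 - X) * R) ^ (k + 1) * A) ?_).mp
      (h2 ▸ dvd_mul_right _ _)
    rw [pow_succ, mul_assoc, mul_assoc, mul_left_comm]
    exact dvd_mul_right _ _
  exact hprime.not_isUnit (hco.isUnit_of_dvd' hA (dvd_mul_right _ _))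

/-- The equation `y - y ^ (k + 2) = X / (1 - X)` has no rational solution `y = A / Q`. -/
theorem one_sub_X_mul_ne {F : Type*} [Field F] {k : ℕ} {A Q : F[X]} (hQ : Q ≠ 0) :
    (1 - X) * (Q ^ (k + 1) * A - A ^ (k + 2)) ≠ X * Q ^ (k + 2) := by
  classical
  intro h
  have hg : EuclideanDomain.gcd A Q ≠ 0 := fun h0 => hQ (EuclideanDomain.gcd_eq_zero_iff.mp h0).2
  obtain ⟨A', hA'⟩ := EuclideanDomain.gcd_dvd_left A Q
  obtain ⟨Q', hQ'⟩ := EuclideanDomain.gcd_dvd_right A Q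
  have hb := EuclideanDomain.gcd_eq_gcd_ab A Q
  generalize EuclideanDomain.gcd A Q = g at hg hA' hQ' hb
  have hco : IsCoprime A' Q' := by
    refine ⟨EuclideanDomain.gcdA A Q, EuclideanDomain.gcdB A Q, mul_left_cancel₀ hg ?_⟩
    generalize EuclideanDomain.gcdA A Q = a at *
    generalize EuclideanDomain.gcdB A Q = b at *
    rw [hA', hQ'] at hb
    linear_combination -hb
  refine one_sub_X_mul_ne_of_isCoprime (k := k) hco (mul_left_cancel₀ (pow_ne_zero (k + 2) hg) ?_)
  rw [hA', hQ'] at h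
  linear_combination h

end ArtinSchreier

section SumOfDigits

open PowerSeries

theorem PowerSeries.pow_card_eq_expand {p : ℕ} [hp : Fact p.Prime] (f : (ZMod p)⟦X⟧) :
    f ^ p = f.expand p hp.out.ne_zero := by
  have h := MvPowerSeries.map_frobenius_expand p hp.out.ne_zero (R := ZMod p) (σ := Unit) (f := f)
  rw [ZMod.frobenius_zmod] at h
  rw [PowerSeries.expand]
  refine Eq.trans h.symm ?_
  simp [MvPowerSeries.map_id]

theorem PowerSeries.coeff_succ_one_sub_X_mul {R : Type*} [CommRing R] (f : R⟦X⟧) (n : ℕ) :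
    coeff (n + 1) ((1 - X) * f) = coeff (n + 1) f - coeff n f := by
  rw [sub_mul, one_mul, map_sub, coeff_succ_X_mul]

variable {p : ℕ} [hp : Fact p.Prime]

/-- The differences of the sum-of-digits sequence satisfy an Artin–Schreier equation. -/
theorem sumOfDigits_artinSchreier {s : ℕ → ZMod p} (hs0 : s 0 = 0)
    (hrec : ∀ n, 1 ≤ n → s n = s (n / p) + (n : ZMod p)) :
    (1 - X) * ((1 - X) * mk s - ((1 - X) * mk s) ^ p) = (X : (ZMod p)⟦X⟧) := by
  have hp2 := hp.out.two_le
  have key : (1 - X) * mk s - ((1 - X) * mk s) ^ p =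
      mk fun n => if n = 0 then (0 : ZMod p) else 1 := by
    ext n
    rw [map_sub, pow_card_eq_expand, coeff_expand, coeff_mk]
    rcases n with _ | n
    · simp [hs0]
    rw [coeff_succ_one_sub_X_mul, coeff_mk, coeff_mk, if_neg n.succ_ne_zero]
    have hrec' : ∀ n, s n = s (n / p) + (n : ZMod p) := by
      intro n
      rcases n with _ | n
      · simp
      · exact hrec _ (by omega)
    rw [hrec' (n + 1), hrec' n]
    have hsd := Nat.succ_div (a := n) (b := p)
    split_ifs at hsd ⊢ with hd
    · rw [hsd, coeff_succ_one_sub_X_mul, coeff_mk, coeff_mk]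
      push_cast
      ring
    · rw [hsd]
      simp
  rw [key]
  ext n
  rcases n with _ | _ | n
  · simp
  · rw [coeff_succ_one_sub_X_mul]
    simp
  · rw [coeff_succ_one_sub_X_mul]
    simp [coeff_X]

theorem sumOfDigits_le_linearComplexity {s : ℕ → ZMod p} (hs0 : s 0 = 0)
    (hrec : ∀ n, 1 ≤ n → s n = s (n / p) + (n : ZMod p)) (N : ℕ) :
    N ≤ p * linearComplexity s N + 1 := by
  obtain ⟨Q, hQ0, hQd, hQ⟩ := LinearComplexity.exists_denominator s N
  have hAS := sumOfDigits_artinSchreier hs0 hrec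
  generalize linearComplexity s N = L at *
  by_contra! hlt
  obtain ⟨k, hk⟩ := Nat.exists_eq_add_of_le' hp.out.two_le
  set H : (ZMod p)⟦X⟧ := (1 - X) * mk s with hH
  set A := trunc (L + 1) ((Q : (ZMod p)⟦X⟧) * H) with hA
  have hAd : A.natDegree ≤ L := Nat.lt_succ_iff.mp (natDegree_trunc_lt _ _)
  have hdvd : (X : (ZMod p)⟦X⟧) ^ N ∣ (Q : (ZMod p)⟦X⟧) * H - (A : (ZMod p)⟦X⟧) := by
    rw [X_pow_dvd_iff]
    intro m hm
    rw [map_sub, Polynomial.coeff_coe, hA, coeff_trunc]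
    split_ifs with hmL
    · exact sub_self _
    obtain ⟨n, rfl⟩ : ∃ n, m = n + 1 := ⟨m - 1, by omega⟩
    rw [hH, mul_left_comm, coeff_succ_one_sub_X_mul, hQ _ (by omega) hm,
      hQ _ (by omega) (by omega)]
    simp
  refine one_sub_X_mul_ne (k := k) (A := A) hQ0 (sub_eq_zero.mp ?_)
  set E : Polynomial (ZMod p) := (1 - Polynomial.X) * (Q ^ (k + 1) * A - A ^ (k + 2))
    - Polynomial.X * Q ^ (k + 2) with hE
  have hEd : E.natDegree ≤ p * L + 1 := by
    have h1 : (Q ^ (k + 1) * A).natDegree ≤ p * L := by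
      refine (Polynomial.natDegree_mul_le_of_le
        (Polynomial.natDegree_pow_le_of_le (k + 1) hQd) hAd).trans (le_of_eq ?_)
      rw [hk]; ring
    have h2 : (A ^ (k + 2)).natDegree ≤ p * L := by
      exact (Polynomial.natDegree_pow_le_of_le (k + 2) hAd).trans (by rw [← hk])
    have h3 : (Q ^ (k + 2)).natDegree ≤ p * L := by
      exact (Polynomial.natDegree_pow_le_of_le (k + 2) hQd).trans (by rw [← hk])
    have h4 : (1 - Polynomial.X : Polynomial (ZMod p)).natDegree ≤ 1 :=
      (Polynomial.natDegree_sub_le _ _).trans (by simp)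
    refine Polynomial.natDegree_sub_le_of_le ?_ ?_ |>.trans (max_self _).le
    · rw [add_comm (p * L)]
      exact Polynomial.natDegree_mul_le_of_le h4
        ((Polynomial.natDegree_sub_le_of_le h1 h2).trans (max_self _).le)
    · rw [add_comm (p * L)]
      exact Polynomial.natDegree_mul_le_of_le Polynomial.natDegree_X_le h3
  have hEN : (X : (ZMod p)⟦X⟧) ^ N ∣ (E : (ZMod p)⟦X⟧) := by
    have hpow := sub_dvd_pow_sub_pow ((Q : (ZMod p)⟦X⟧) * H) (A : (ZMod p)⟦X⟧) (k + 2)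
    have hHp : H ^ p = H ^ (k + 2) := congrArg (H ^ ·) hk
    rw [hHp] at hAS
    have hcast : (E : (ZMod p)⟦X⟧) =
        (1 - X) * ((((Q : (ZMod p)⟦X⟧) * H) ^ (k + 2) - (A : (ZMod p)⟦X⟧) ^ (k + 2))
          - (Q : (ZMod p)⟦X⟧) ^ (k + 1) * ((Q : (ZMod p)⟦X⟧) * H - (A : (ZMod p)⟦X⟧))) := by
      rw [hE]
      push_cast
      rw [mul_pow]
      clear_value H
      linear_combination (Q : (ZMod p)⟦X⟧) ^ (k + 2) * hAS
    rw [hcast]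
    exact ((hdvd.trans hpow).sub (hdvd.mul_left _)).mul_left _
  ext n
  rw [Polynomial.coeff_zero]
  by_cases hn : n < N
  · rw [← Polynomial.coeff_coe]
    exact X_pow_dvd_iff.mp hEN n hn
  · exact Polynomial.coeff_eq_zero_of_natDegree_lt (by omega)

theorem sumOfDigits_linearComplexity_le {s : ℕ → ZMod p} (hs0 : s 0 = 0)
    (hrec : ∀ n, 1 ≤ n → s n = s (n / p) + (n : ZMod p)) {N : ℕ} (hN : 1 ≤ N) :
    p * linearComplexity s N + N ≤ p * N + 2 := by
  have hp2 := hp.out.two_le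
  induction N, hN using Nat.le_induction with
  | base =>
    have : linearComplexity s 1 ≤ 0 := by
      refine LinearComplexity.le_of_recurrence Fin.elim0 fun n hn => ?_
      obtain rfl : n = 0 := by omega
      simpa using hs0
    rw [Nat.le_zero.mp this]
    omega
  | succ N hN ih =>
    have hlow := sumOfDigits_le_linearComplexity hs0 hrec N
    have hLN := LinearComplexity.le_self s N
    rcases le_max_iff.mp (LinearComplexity.succ_le s N) with h | h
    · nlinarith
    · have h' : linearComplexity s (N + 1) + linearComplexity s N ≤ N + 1 := by omega
      nlinarith

end SumOfDigits

theorem sumOfDigits_linearComplexity_bounds (p : ℕ) [Fact p.Prime]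
    (s : ℕ → ZMod p) (hs0 : s 0 = 0)
    (hrec : ∀ n, 1 ≤ n → s n = s (n / p) + (n : ZMod p))
    (N : ℕ) (hN : 1 ≤ N) :
    ((N : ℚ) - 1) / p ≤ (linearComplexity s N : ℚ) ∧
      (linearComplexity s N : ℚ) ≤ (((p : ℚ) - 1) * N + 2) / p := by
  have hp : (0 : ℚ) < p := Nat.cast_pos.mpr (Fact.out : p.Prime).pos
  have hlow : (N : ℚ) ≤ p * linearComplexity s N + 1 := by
    exact_mod_cast sumOfDigits_le_linearComplexity hs0 hrec N
  have hupp : (p : ℚ) * linearComplexity s N + N ≤ p * N + 2 := by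
    exact_mod_cast sumOfDigits_linearComplexity_le hs0 hrec hN
  rw [div_le_iff₀ hp, le_div_iff₀ hp]
  constructor <;> linarith
end

section
/- Let (b_n) be the Baum–Sweet sequence over F_2. Then for every N ≥ 1, N/3 ≤ L(b_n,N) ≤ (2N+1)/3. -/
theorem coeff_sq_zmod_two (f : PowerSeries (ZMod 2)) (n : ℕ) :
    PowerSeries.coeff n (f ^ 2) = if 2 ∣ n then PowerSeries.coeff (n / 2) f else 0 := by
  have := MvPowerSeries.map_frobenius_expand 2 two_ne_zero (f := f)
  rw [ZMod.frobenius_zmod, MvPowerSeries.map_id, RingHom.id_apply] at this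
  rw [← PowerSeries.coeff_expand 2 two_ne_zero f, ← this, PowerSeries.expand]

theorem isUnit_of_dvd_pow {R : Type*} [CommRing R] {p q : R} (h : IsCoprime p q)
    (k : ℕ) (hd : p ∣ q ^ k) : IsUnit p :=
  (h.pow_right (n := k)).isUnit_of_dvd hd

theorem eq_zero_of_cubic_form_eq_zero {g h : Polynomial (ZMod 2)}
    (e : g ^ 3 + Polynomial.X * g * h ^ 2 + h ^ 3 = 0) : h = 0 := by
  by_contra hh
  have hd : EuclideanDomain.gcd g h ≠ 0 := fun hd => hh (EuclideanDomain.gcd_eq_zero_iff.1 hd).2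
  obtain ⟨p, hp⟩ := EuclideanDomain.gcd_dvd_left g h
  obtain ⟨q, hq⟩ := EuclideanDomain.gcd_dvd_right g h
  set d := EuclideanDomain.gcd g h
  have hpq : IsCoprime p q := by
    refine ⟨EuclideanDomain.gcdA g h, EuclideanDomain.gcdB g h, mul_left_cancel₀ hd ?_⟩
    have := EuclideanDomain.gcd_eq_gcd_ab g h
    change d = _ at this
    generalize EuclideanDomain.gcdA g h = a at *
    generalize EuclideanDomain.gcdB g h = b at *
    generalize d = d at *
    subst hp hq
    linear_combination -this
  have e' : p ^ 3 + Polynomial.X * p * q ^ 2 + q ^ 3 = 0 := by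
    apply mul_left_cancel₀ (pow_ne_zero 3 hd)
    rw [hp, hq] at e
    linear_combination e
  have hpu : IsUnit p := isUnit_of_dvd_pow hpq 3
    ⟨-(p ^ 2 + Polynomial.X * q ^ 2), by linear_combination e'⟩
  have hqu : IsUnit q := isUnit_of_dvd_pow hpq.symm 3
    ⟨-(Polynomial.X * p * q + q ^ 2), by linear_combination e'⟩
  obtain ⟨r, hr, rfl⟩ := Polynomial.isUnit_iff.1 hpu
  obtain ⟨s, hs, rfl⟩ := Polynomial.isUnit_iff.1 hqu
  have := congrArg (Polynomial.coeff · 1) e'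
  have hrs : r * s ^ 2 = 0 := by
    simpa [← Polynomial.C_pow, mul_assoc, ← Polynomial.C_mul, -map_mul, -map_pow,
      Polynomial.coeff_C] using this
  exact (hr.mul (hs.pow 2)).ne_zero hrs

theorem baumSweet_cubic (b : ℕ → ZMod 2) (hb0 : b 0 = 1)
    (hrec : ∀ c m : ℕ, 1 ≤ m → ¬ (4 ∣ m) →
      b (4 ^ c * m) = if m % 2 = 0 then 0 else b ((m - 1) / 2)) :
    (PowerSeries.mk b) ^ 3 + PowerSeries.X * PowerSeries.mk b + 1 = 0 := by
  set G := PowerSeries.mk b with hG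
  have hG0 : G ≠ 0 := fun h => by
    have := congrArg (PowerSeries.coeff 0) h
    rw [hG, PowerSeries.coeff_mk, hb0] at this
    simp at this
  have h4 (k : ℕ) : b (4 * k) = b k := by
    rcases Nat.eq_zero_or_pos k with rfl | hk
    · rfl
    obtain ⟨c, m, hm, rfl⟩ := Nat.exists_eq_pow_mul_and_not_dvd hk.ne' 4 (by norm_num)
    have hm1 : 1 ≤ m := Nat.one_le_iff_ne_zero.2 fun h => hm (h ▸ dvd_zero 4)
    rw [← mul_assoc, ← pow_succ', hrec _ _ hm1 hm, hrec _ _ hm1 hm]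
  have h2 (k : ℕ) : b (4 * k + 2) = 0 := by
    simpa [show (4 * k + 2) % 2 = 0 by omega] using hrec 0 (4 * k + 2) (by omega) (by omega)
  have h1 (k : ℕ) : b (2 * k + 1) = b k := by
    simpa [show (2 * k + 1) % 2 = 1 by omega] using hrec 0 (2 * k + 1) (by omega) (by omega)
  have key : PowerSeries.X * G ^ 2 + (G ^ 2) ^ 2 = G := by
    ext n
    rw [map_add, coeff_sq_zmod_two, coeff_sq_zmod_two]
    obtain ⟨k, rfl | rfl | rfl⟩ : ∃ k, n = 4 * k ∨ n = 4 * k + 2 ∨ n = 2 * k + 1 := by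
      rcases (by omega : n % 4 = 0 ∨ n % 4 = 2 ∨ n % 2 = 1) with h | h | h
      exacts [⟨n / 4, by omega⟩, ⟨n / 4, by omega⟩, ⟨n / 2, by omega⟩]
    · rw [if_pos (by omega), if_pos (by omega), hG, PowerSeries.coeff_mk, PowerSeries.coeff_mk,
        show 4 * k / 2 / 2 = k by omega, h4]
      rcases k with _ | k
      · simp
      · rw [show 4 * (k + 1) = 4 * k + 3 + 1 by omega, PowerSeries.coeff_succ_X_mul,
          coeff_sq_zmod_two, if_neg (by omega), zero_add]
    · rw [if_pos (by omega), if_neg (by omega), hG, PowerSeries.coeff_mk,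
        PowerSeries.coeff_succ_X_mul, coeff_sq_zmod_two, if_neg (by omega), h2, add_zero]
    · rw [if_neg (by omega), hG, PowerSeries.coeff_mk, PowerSeries.coeff_succ_X_mul,
        coeff_sq_zmod_two, if_pos (by omega), PowerSeries.coeff_mk, h1, add_zero]
      congr 1; omega
  apply mul_left_cancel₀ hG0
  have : (2 : PowerSeries (ZMod 2)) = 0 := by
    rw [← map_ofNat (PowerSeries.C (R := ZMod 2))]
    exact (congrArg _ (CharTwo.two_eq_zero (R := ZMod 2))).trans (map_zero _)
  linear_combination key + G * this

theorem le_three_mul_of_recurrence {b : ℕ → ZMod 2}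
    (hb : (PowerSeries.mk b) ^ 3 + PowerSeries.X * PowerSeries.mk b + 1 = 0)
    {L N : ℕ} {c : Fin L → ZMod 2}
    (hc : ∀ n, n + L < N → b (n + L) = ∑ i, c i * b (n + i)) : N ≤ 3 * L := by
  by_contra! hlt
  set G := PowerSeries.mk b with hG
  let h : Polynomial (ZMod 2) := 1 - ∑ i : Fin L, Polynomial.C (c i) * Polynomial.X ^ (L - i)
  let g : Polynomial (ZMod 2) := PowerSeries.trunc L (h * G)
  have hne : h ≠ 0 := fun h0 => by
    have := congrArg (Polynomial.coeff · 0) h0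
    simp [h, Polynomial.coeff_X_pow] at this
    rw [Finset.sum_eq_zero] at this
    · simp at this
    · intro i _
      rw [if_neg (by omega)]
  have hh : h.natDegree ≤ L := by
    refine (Polynomial.natDegree_sub_le _ _).trans (max_le (by simp) ?_)
    refine Polynomial.natDegree_sum_le_of_forall_le _ _ fun i _ => ?_
    exact (Polynomial.natDegree_C_mul_X_pow_le _ _).trans (Nat.sub_le _ _)
  have hg : g = 0 ∨ g.natDegree + 1 ≤ L := by
    refine or_iff_not_imp_left.2 fun h0 => ?_
    exact (Polynomial.natDegree_lt_iff_degree_lt h0).2 (PowerSeries.degree_trunc_lt _ _)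
  have hdvd : (PowerSeries.X : PowerSeries (ZMod 2)) ^ N ∣ (h : PowerSeries (ZMod 2)) * G - g := by
    refine PowerSeries.X_pow_dvd_iff.2 fun m hm => ?_
    rw [map_sub, Polynomial.coeff_coe, PowerSeries.coeff_trunc]
    split_ifs with hmL
    · simp
    obtain ⟨n, rfl⟩ := Nat.exists_eq_add_of_le' (not_lt.1 hmL)
    have hcoe : (h : PowerSeries (ZMod 2)) =
        1 - ∑ i : Fin L, PowerSeries.C (c i) * PowerSeries.X ^ (L - i : ℕ) := by
      have := map_sum (Polynomial.coeToPowerSeries.ringHom (R := ZMod 2))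
        (fun i : Fin L => Polynomial.C (c i) * Polynomial.X ^ (L - i : ℕ)) Finset.univ
      simp only [Polynomial.coeToPowerSeries.ringHom_apply] at this
      simp [h, Polynomial.coe_sub, this]
    rw [sub_zero, hcoe, sub_mul, one_mul, map_sub, Finset.sum_mul, map_sum, hG,
      PowerSeries.coeff_mk, hc n hm, sub_eq_zero]
    refine Finset.sum_congr rfl fun i _ => ?_
    rw [mul_assoc, PowerSeries.coeff_C_mul, PowerSeries.coeff_X_pow_mul', if_pos (by omega),
      PowerSeries.coeff_mk]
    congr 2; omega
  have hpoly : (Polynomial.X : Polynomial (ZMod 2)) ^ N ∣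
      g ^ 3 + Polynomial.X * g * h ^ 2 + h ^ 3 := by
    rw [Polynomial.X_pow_dvd_iff]
    simp only [← Polynomial.coeff_coe]
    rw [← PowerSeries.X_pow_dvd_iff]
    push_cast
    obtain ⟨t, ht⟩ := hdvd
    generalize (h : PowerSeries (ZMod 2)) = h' at ht ⊢
    generalize (g : PowerSeries (ZMod 2)) = g' at ht ⊢
    refine ⟨-t * ((h' * G) ^ 2 + h' * G * g' + g' ^ 2 + PowerSeries.X * h' ^ 2), ?_⟩
    linear_combination h' ^ 3 * hb -
      ((h' * G) ^ 2 + h' * G * g' + g' ^ 2 + PowerSeries.X * h' ^ 2) * ht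
  have hdeg : (g ^ 3 + Polynomial.X * g * h ^ 2 + h ^ 3).natDegree < N := by
    refine lt_of_le_of_lt ?_ hlt
    have hh3 : (h ^ 3).natDegree ≤ 3 * L := Polynomial.natDegree_pow_le_of_le 3 hh
    rcases hg with h0 | hg
    · simpa [h0] using hh3
    refine Polynomial.natDegree_add_le_of_degree_le (Polynomial.natDegree_add_le_of_degree_le
      (Polynomial.natDegree_pow_le_of_le 3 (by omega)) ?_) hh3
    refine Polynomial.natDegree_mul_le.trans ?_
    have h1 := Polynomial.natDegree_mul_le (p := Polynomial.X) (q := g)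
    have h2 : (h ^ 2).natDegree ≤ 2 * L := Polynomial.natDegree_pow_le_of_le 2 hh
    have h3 := Polynomial.natDegree_X_le (R := ZMod 2)
    omega
  refine hne (eq_zero_of_cubic_form_eq_zero (g := g) ?_)
  exact Polynomial.eq_zero_of_dvd_of_natDegree_lt hpoly (by simpa using hdeg)

/-- Either the first `L + K` terms satisfy a recurrence of length `L`, or, for some `M < K`, the
first `L + M` terms satisfy a recurrence of length `M`. -/
theorem exists_recurrence_or_exists_short_recurrence {F : Type*} [Field F] (u : ℕ → F) (L K : ℕ) :
    (∃ c : Fin L → F, ∀ n, n < K → u (n + L) = ∑ i, c i * u (n + i)) ∨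
      ∃ M, M < K ∧ ∃ c : Fin M → F, ∀ n, n < L → u (n + M) = ∑ i, c i * u (n + i) := by
  classical
  by_cases hli : LinearIndependent F (fun (n : Fin K) (i : Fin L) => u (n + i))
  · left
    let A : Matrix (Fin K) (Fin L) F := Matrix.of fun n i => u (n + i)
    have hrank : A.rank = Fintype.card (Fin K) := LinearIndependent.rank_matrix hli
    have htop : LinearMap.range A.mulVecLin = ⊤ :=
      Submodule.eq_top_of_finrank_eq (hrank.trans (Module.finrank_fintype_fun_eq_card F).symm)
    obtain ⟨c, hc⟩ := LinearMap.range_eq_top.1 htop fun n => u (n + L)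
    refine ⟨c, fun n hn => ?_⟩
    rw [← congrFun hc ⟨n, hn⟩]
    simp [A, Matrix.mulVec, dotProduct, mul_comm]
  · right
    obtain ⟨y, hy, k, hk⟩ := Fintype.not_linearIndependent_iff.1 hli
    obtain ⟨M, hM, hmax⟩ := Finset.exists_max_image (Finset.univ.filter (y · ≠ 0)) id ⟨k, by simpa⟩
    have hM0 : y M ≠ 0 := by simpa using hM
    have hmax (j : Fin K) (hj : M < j) : y j = 0 := by
      by_contra h
      exact (hmax j (by simpa using h)).not_gt hj
    refine ⟨M, M.2, fun j => -(y M)⁻¹ * y (j.castLE M.2.le), fun n hn => ?_⟩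
    let y' : ℕ → F := fun j => if h : j < K then y ⟨j, h⟩ else 0
    have hsum : ∑ j ∈ Finset.range (M + 1), y' j * u (j + n) = 0 := by
      rw [Finset.sum_subset (Finset.range_subset_range.2 M.2), ← Fin.sum_univ_eq_sum_range
        (fun j => y' j * u (j + n))]
      · simpa [y'] using congrFun hy ⟨n, hn⟩
      · intro j hjK hjM
        rw [Finset.mem_range] at hjK hjM
        simp [y', hjK, hmax ⟨j, hjK⟩ (Fin.lt_def.2 (by simpa using hjM))]
    rw [Finset.sum_range_succ, ← Fin.sum_univ_eq_sum_range (fun j => y' j * u (j + n))] at hsum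
    have hy' (j : Fin M) : y' j = y (j.castLE M.2.le) := by
      simp [y', j.2.trans M.2, Fin.castLE]
    simp only [hy'] at hsum
    have hyM : y' M = y M := by simp [y']
    rw [hyM, add_comm (M : ℕ) n] at hsum
    simp_rw [mul_assoc, ← Finset.mul_sum, add_comm n]
    rw [add_comm (M : ℕ) n, eq_neg_of_add_eq_zero_left hsum]
    field_simp

theorem exists_recurrence_linearComplexity {F : Type*} [Field F] (u : ℕ → F) (N : ℕ) :
    ∃ c : Fin (linearComplexity u N) → F, ∀ n, n + linearComplexity u N < N →
      u (n + linearComplexity u N) = ∑ i, c i * u (n + i) :=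
  Nat.sInf_mem (s := {L | ∃ c : Fin L → F, ∀ n, n + L < N → u (n + L) = ∑ i, c i * u (n + i)})
    ⟨N, 0, fun n hn => absurd hn (by omega)⟩

theorem baumSweet_linearComplexity_bounds (b : ℕ → ZMod 2) (hb0 : b 0 = 1)
    (hrec : ∀ c m : ℕ, 1 ≤ m → ¬ (4 ∣ m) →
      b (4 ^ c * m) = if m % 2 = 0 then 0 else b ((m - 1) / 2))
    (N : ℕ) (hN : 1 ≤ N) :
    (N : ℚ) / 3 ≤ (linearComplexity b N : ℚ) ∧
      (linearComplexity b N : ℚ) ≤ (2 * (N : ℚ) + 1) / 3 := by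
  have hb := baumSweet_cubic b hb0 hrec
  obtain ⟨c, hc⟩ := exists_recurrence_linearComplexity b N
  have hlower := le_three_mul_of_recurrence hb hc
  have hupper : linearComplexity b N ≤ (2 * N + 1) / 3 := by
    refine Nat.sInf_le ?_
    rcases exists_recurrence_or_exists_short_recurrence b ((2 * N + 1) / 3)
      (N - (2 * N + 1) / 3) with ⟨c, hc⟩ | ⟨M, hM, c, hc⟩
    · exact ⟨c, fun n hn => hc n (by omega)⟩
    · have := le_three_mul_of_recurrence hb (N := (2 * N + 1) / 3 + M)
        fun n hn => hc n (by omega)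
      omega
  constructor
  · rw [div_le_iff₀ (by norm_num), mul_comm]
    exact_mod_cast hlower
  · rw [le_div_iff₀ (by norm_num), mul_comm]
    exact_mod_cast (show 3 * linearComplexity b N ≤ 2 * N + 1 by omega)
end

section
/- Let (t_n) be the Thue–Morse sequence over F_2. Then for every N ≥ 1, L(t_n,N) = 2⌊(N+2)/4⌋. -/
open Polynomial in
/-- The quadratic form over `𝔽₂[X]` whose dehomogenization annihilates the generating function
of the Thue–Morse sequence. -/
noncomputable def thueMorseForm (A B : (ZMod 2)[X]) : (ZMod 2)[X] :=
  (1 + X) ^ 3 * B ^ 2 + (1 + X) ^ 2 * A * B + X * A ^ 2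

open Polynomial in
lemma natDegree_thueMorseForm_le {A B : (ZMod 2)[X]} {l : ℕ} (hA : A.natDegree ≤ l + 1)
    (hB : B.natDegree ≤ l) : (thueMorseForm A B).natDegree ≤ 2 * (l + 1) + 1 := by
  have h1 : (1 + X : (ZMod 2)[X]).natDegree ≤ 1 := by compute_degree
  have h2 : ((1 + X : (ZMod 2)[X]) ^ 2).natDegree ≤ 2 := by compute_degree
  have h3 : ((1 + X : (ZMod 2)[X]) ^ 3).natDegree ≤ 3 := by compute_degree
  have hB2 := natDegree_pow_le_of_le 2 hB
  have hA2 := natDegree_pow_le_of_le 2 hA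
  unfold thueMorseForm
  refine natDegree_add_le_of_degree_le (natDegree_add_le_of_degree_le ?_ ?_) ?_
  · exact (natDegree_mul_le_of_le h3 hB2).trans (by omega)
  · exact (natDegree_mul_le_of_le (natDegree_mul_le_of_le h2 hA) hB).trans (by omega)
  · exact (natDegree_mul_le_of_le natDegree_X_le hA2).trans (by omega)

open Polynomial in
lemma coeff_thueMorseForm {A B : (ZMod 2)[X]} {l : ℕ} (hA : A.natDegree ≤ l + 1)
    (hB : B.natDegree ≤ l) :
    (thueMorseForm A B).coeff (2 * (l + 1) + 1) =
      B.coeff l ^ 2 + A.coeff (l + 1) * B.coeff l + A.coeff (l + 1) ^ 2 := by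
  have h1 : (1 + X : (ZMod 2)[X]).natDegree ≤ 1 := by compute_degree
  have h2 : ((1 + X : (ZMod 2)[X]) ^ 2).natDegree ≤ 2 := by compute_degree
  have h3 : ((1 + X : (ZMod 2)[X]) ^ 3).natDegree ≤ 3 := by compute_degree
  have c1 : (1 + X : (ZMod 2)[X]).coeff 1 = 1 := by simp [coeff_one]
  have c2 : ((1 + X : (ZMod 2)[X]) ^ 2).coeff 2 = 1 := by
    simpa [c1] using coeff_pow_of_natDegree_le (m := 2) h1
  have c3 : ((1 + X : (ZMod 2)[X]) ^ 3).coeff 3 = 1 := by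
    simpa [c1] using coeff_pow_of_natDegree_le (m := 3) h1
  have hB2 := natDegree_pow_le_of_le 2 hB
  have hA2 := natDegree_pow_le_of_le 2 hA
  have e1 := coeff_mul_add_eq_of_natDegree_le h3 hB2
  have e2 := coeff_mul_add_eq_of_natDegree_le (natDegree_mul_le_of_le h2 hA) hB
  have e3 := coeff_mul_add_eq_of_natDegree_le (natDegree_X_le (R := ZMod 2)) hA2
  rw [coeff_mul_add_eq_of_natDegree_le h2 hA, c2, one_mul] at e2
  rw [c3, coeff_pow_of_natDegree_le hB, one_mul] at e1
  rw [coeff_X_one, coeff_pow_of_natDegree_le hA, one_mul] at e3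
  rw [show 3 + 2 * l = 2 * (l + 1) + 1 by ring] at e1
  rw [show 2 + (l + 1) + l = 2 * (l + 1) + 1 by ring] at e2
  rw [show 1 + 2 * (l + 1) = 2 * (l + 1) + 1 by ring] at e3
  rw [thueMorseForm, coeff_add, coeff_add, e1, e2, e3]

open Polynomial in
lemma eq_zero_of_thueMorseForm_eq_zero {A B : (ZMod 2)[X]} {l : ℕ} (hA : A.natDegree ≤ l + 1)
    (hB : B.natDegree ≤ l) (h : thueMorseForm A B = 0) : A = 0 := by
  have key : ∀ {m : ℕ}, A.natDegree ≤ m + 1 → B.natDegree ≤ m →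
      A.coeff (m + 1) = 0 ∧ B.coeff m = 0 := by
    intro m hA hB
    have e := coeff_thueMorseForm hA hB
    rw [h, coeff_zero] at e
    generalize A.coeff (m + 1) = a at *
    generalize B.coeff m = b at *
    revert a b
    decide
  have drop : ∀ {P : (ZMod 2)[X]} {m : ℕ}, P.natDegree ≤ m + 1 → P.coeff (m + 1) = 0 →
      P.natDegree ≤ m := by
    intro P m h1 h2
    rw [natDegree_le_iff_coeff_eq_zero] at h1 ⊢
    intro N hN
    rcases Nat.lt_or_ge (m + 1) N with h | h
    · exact h1 N h
    · rwa [show N = m + 1 by omega]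
  induction l with
  | zero =>
    obtain ⟨-, hb⟩ := key hA hB
    have hB0 : B = 0 := by rw [eq_C_of_natDegree_le_zero hB, hb, C_0]
    subst hB0
    simpa [thueMorseForm] using h
  | succ l ih =>
    obtain ⟨ha, hb⟩ := key hA hB
    exact ih (drop hA ha) (drop hB hb)

open Polynomial in
lemma eval_one_derivative_thueMorseForm (A B : (ZMod 2)[X]) :
    (derivative (thueMorseForm A B)).eval 1 = (thueMorseForm A B).eval 1 := by
  have h2 : (1 + 1 : ZMod 2) = 0 := by decide
  have h2' : (2 : ZMod 2) = 0 := by decide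
  simp [thueMorseForm, h2, h2', derivative_pow]

open Polynomial in
lemma coeff_thueMorseForm_eq_zero {A B : (ZMod 2)[X]} {l : ℕ} (hA : A.natDegree ≤ l + 1)
    (hB : B.natDegree ≤ l) (h : ∀ i < 2 * (l + 1), (thueMorseForm A B).coeff i = 0) :
    (thueMorseForm A B).coeff (2 * (l + 1)) = 0 := by
  have hd := natDegree_thueMorseForm_le hA hB
  have he := eval_one_derivative_thueMorseForm A B
  generalize thueMorseForm A B = P at *
  have hP : P = C (P.coeff (2 * (l + 1))) * X ^ (2 * (l + 1)) +
      C (P.coeff (2 * (l + 1) + 1)) * X ^ (2 * (l + 1) + 1) := by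
    ext i
    rw [natDegree_le_iff_coeff_eq_zero] at hd
    simp only [coeff_add, coeff_C_mul, coeff_X_pow]
    rcases Nat.lt_or_ge i (2 * (l + 1)) with hi | hi
    · rw [h i hi, if_neg (by omega), if_neg (by omega)]; simp
    rcases Nat.lt_or_ge (2 * (l + 1) + 1) i with hi' | hi'
    · rw [hd i hi', if_neg (by omega), if_neg (by omega)]; simp
    obtain rfl | rfl : i = 2 * (l + 1) ∨ i = 2 * (l + 1) + 1 := by omega
    · simp
    · simp
  generalize P.coeff (2 * (l + 1)) = a at *
  generalize P.coeff (2 * (l + 1) + 1) = c at *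
  have h2 : (2 : ZMod 2) = 0 := by decide
  rw [hP] at he
  simpa [derivative_X_pow, h2] using he

/-- The first `N` terms of `u` satisfy a linear recurrence of length `L`. -/
def SatisfiesRecurrence {F : Type*} [Field F] (u : ℕ → F) (L N : ℕ) : Prop :=
  ∃ c : Fin L → F, ∀ n, n + L < N → u (n + L) = ∑ i, c i * u (n + i)

lemma SatisfiesRecurrence.mono {F : Type*} [Field F] {u : ℕ → F} {L M N : ℕ}
    (h : SatisfiesRecurrence u L N) (hMN : M ≤ N) : SatisfiesRecurrence u L M := by
  obtain ⟨c, hc⟩ := h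
  exact ⟨c, fun n hn => hc n (by omega)⟩

/-- Linear algebra: `D + 1` unknown coefficients against `D` equations. -/
lemma exists_satisfiesRecurrence {F : Type*} [Field F] (u : ℕ → F) (D : ℕ) :
    ∃ d ≤ D, SatisfiesRecurrence u d (d + D) := by
  let f : (Fin (D + 1) → F) →ₗ[F] (Fin D → F) :=
    Matrix.mulVecLin (Matrix.of fun n i => u (n + i))
  have hf : LinearMap.ker f ≠ ⊥ := LinearMap.ker_ne_bot_of_finrank_lt (by simp)
  obtain ⟨q, hq, hq0⟩ := (Submodule.ne_bot_iff _).1 hf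
  let g : ℕ → F := fun i => if h : i < D + 1 then q ⟨i, h⟩ else 0
  have hg : ∃ i ≤ D, g i ≠ 0 := by
    obtain ⟨i, hi⟩ := Function.ne_iff.1 hq0
    exact ⟨i, by omega, by simpa [g, Nat.le_of_lt_succ i.2] using hi⟩
  obtain ⟨i₀, hi₀, hgi₀⟩ := hg
  classical
  let d := Nat.findGreatest (fun i => g i ≠ 0) D
  have hd : g d ≠ 0 := Nat.findGreatest_spec (P := fun i => g i ≠ 0) hi₀ hgi₀
  have hdD : d ≤ D := Nat.findGreatest_le D
  have hgt : ∀ i, d < i → g i = 0 := by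
    intro i hi
    by_cases hiD : i ≤ D
    · exact not_not.1 (Nat.findGreatest_is_greatest (P := fun i => g i ≠ 0) hi hiD)
    · simp only [g]
      rw [dif_neg (by omega)]
  have hsum : ∀ n < D, ∑ i ∈ Finset.range (d + 1), g i * u (n + i) = 0 := by
    intro n hn
    have h := congrFun (LinearMap.mem_ker.1 hq) ⟨n, hn⟩
    have h' : ∑ i : Fin (D + 1), g i * u (n + i) = 0 := by
      simpa [f, g, Nat.le_of_lt_succ (Fin.is_lt _), Matrix.mulVec, dotProduct, mul_comm] using h
    rw [Fin.sum_univ_eq_sum_range (fun i => g i * u (n + i))] at h'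
    rw [← h']
    refine Finset.sum_subset (by intro i; simp; omega) ?_
    intro i _ hi
    rw [hgt i (by simpa using hi), zero_mul]
  refine ⟨d, hdD, fun i => -(g d)⁻¹ * g i, fun n hn => ?_⟩
  have h := hsum n (by omega)
  rw [Finset.sum_range_succ] at h
  rw [Fin.sum_univ_eq_sum_range (fun i => -(g d)⁻¹ * g i * u (n + i))]
  simp_rw [mul_assoc]
  rw [← Finset.mul_sum, eq_neg_of_add_eq_zero_left h]
  field_simp

section ThueMorse

variable {t : ℕ → ZMod 2}

open PowerSeries in
lemma thueMorse_functional_equation (he : ∀ n, t (2 * n) = t n)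
    (ho : ∀ n, t (2 * n + 1) = t n + 1) :
    (1 + X) ^ 3 * mk t ^ 2 + (1 + X) ^ 2 * mk t + X = 0 := by
  have h2 : (2 : (ZMod 2)⟦X⟧) = 0 := by
    rw [← map_ofNat (C (R := ZMod 2)) 2, show (OfNat.ofNat 2 : ZMod 2) = 0 by decide, map_zero]
  have hsq : mk t ^ 2 = expand 2 two_ne_zero (mk t) := by
    have h := MvPowerSeries.map_frobenius_expand (σ := Unit) (R := ZMod 2) 2 two_ne_zero
      (f := mk t)
    rw [ZMod.frobenius_zmod, MvPowerSeries.map_id] at h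
    exact h.symm
  have heven : ∀ n, coeff (2 * n) (mk t ^ 2) = t n := by
    intro n; rw [hsq, coeff_expand_mul, coeff_mk]
  have hodd : ∀ n, coeff (2 * n + 1) (mk t ^ 2) = 0 := by
    intro n; rw [hsq, coeff_expand_of_not_dvd _ _ _ (by omega)]
  have hK : (1 + X ^ 2) * (mk t + mk t ^ 2 + X * mk t ^ 2) = X := by
    have hKe : ∀ n, coeff (2 * n) (mk t + mk t ^ 2 + X * mk t ^ 2) = 0 := by
      intro n
      rw [map_add, map_add, coeff_mk, heven, he, CharTwo.add_self_eq_zero, zero_add]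
      rcases n with _ | n
      · simp
      · rw [show 2 * (n + 1) = (2 * n + 1) + 1 by ring, coeff_succ_X_mul, hodd]
    have hKo : ∀ n, coeff (2 * n + 1) (mk t + mk t ^ 2 + X * mk t ^ 2) = 1 := by
      intro n
      rw [map_add, map_add, coeff_mk, hodd, coeff_succ_X_mul, heven, ho, add_zero,
        add_right_comm, CharTwo.add_self_eq_zero, zero_add]
    generalize mk t + mk t ^ 2 + X * mk t ^ 2 = K at *
    ext n
    rw [add_mul, one_mul, map_add, coeff_X_pow_mul', coeff_X]
    rcases Nat.even_or_odd' n with ⟨m, rfl | rfl⟩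
    · rw [hKe, if_neg (show ¬ 2 * m = 1 by omega)]
      split_ifs
      · rw [show 2 * m - 2 = 2 * (m - 1) by omega, hKe, add_zero]
      · rw [add_zero]
    · rw [hKo]
      rcases m with _ | m
      · simp
      · rw [if_pos (by omega), if_neg (by omega),
          show 2 * (m + 1) + 1 - 2 = 2 * m + 1 by omega, hKo]
        decide
  linear_combination hK + (X * mk t + X * mk t ^ 2 + X ^ 2 * mk t ^ 2 + X) * h2

open Polynomial in
/-- A recurrence satisfied up to the term of index `n + l` turns the quadratic form into a power
series divisible by `X ^ (n + l + 1)`, and the next coefficient is the defect of the recurrence. -/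
lemma exists_thueMorseForm_eq (h0 : t 0 = 0) (he : ∀ n, t (2 * n) = t n)
    (ho : ∀ n, t (2 * n + 1) = t n + 1) {l n : ℕ} (c : Fin (l + 1) → ZMod 2)
    (hc : ∀ m < n, t (m + (l + 1)) = ∑ i, c i * t (m + i)) :
    ∃ A B : (ZMod 2)[X], A ≠ 0 ∧ A.natDegree ≤ l + 1 ∧ B.natDegree ≤ l ∧
      (∀ i < n + (l + 1), (thueMorseForm A B).coeff i = 0) ∧
      (thueMorseForm A B).coeff (n + (l + 1)) =
        t (n + (l + 1)) + ∑ i, c i * t (n + i) := by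
  let A : (ZMod 2)[X] := 1 + ∑ i : Fin (l + 1), C (c i) * X ^ (l + 1 - i : ℕ)
  have hA0 : A.coeff 0 = 1 := by
    simp only [A, coeff_add, coeff_one_zero, finsetSum_coeff]
    rw [Finset.sum_eq_zero, add_zero]
    intro i _
    rw [coeff_C_mul_X_pow, if_neg (by omega)]
  have hA : A.natDegree ≤ l + 1 := by
    refine natDegree_add_le_of_degree_le (by simp) (natDegree_sum_le_of_forall_le _ _ ?_)
    intro i _
    exact (natDegree_C_mul_X_pow_le _ _).trans (by omega)
  let G : PowerSeries (ZMod 2) := PowerSeries.mk t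
  let P : PowerSeries (ZMod 2) := A * G
  have hP : ∀ m, PowerSeries.coeff (m + (l + 1)) P =
      t (m + (l + 1)) + ∑ i, c i * t (m + i) := by
    intro m
    have hcoe : (A : PowerSeries (ZMod 2)) =
        1 + ∑ i : Fin (l + 1), PowerSeries.C (c i) * PowerSeries.X ^ (l + 1 - i : ℕ) := by
      rw [← coeToPowerSeries.ringHom_apply, map_add, map_one, map_sum]
      simp
    simp only [P, hcoe, add_mul, one_mul, Finset.sum_mul, map_add, map_sum, mul_assoc, G,
      PowerSeries.coeff_mk, PowerSeries.coeff_C_mul, PowerSeries.coeff_X_pow_mul']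
    congr 1
    refine Finset.sum_congr rfl fun i _ => ?_
    rw [if_pos (by omega), show m + (l + 1) - (l + 1 - i) = m + i by omega]
  have hP0 : ∀ m < n, PowerSeries.coeff (m + (l + 1)) P = 0 := by
    intro m hm
    rw [hP, hc m hm, CharTwo.add_self_eq_zero]
  let M := n + (l + 1)
  let B := PowerSeries.trunc M P
  have hB : B.natDegree ≤ l := by
    rw [natDegree_le_iff_coeff_eq_zero]
    intro i hi
    simp only [B, PowerSeries.coeff_trunc]
    split_ifs with h
    · rw [show i = (i - (l + 1)) + (l + 1) by omega]
      exact hP0 _ (by omega)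
    · rfl
  let R : PowerSeries (ZMod 2) := PowerSeries.mk fun i => PowerSeries.coeff (i + M) P
  have hPB : P = PowerSeries.X ^ M * R + (B : PowerSeries (ZMod 2)) :=
    PowerSeries.eq_X_pow_mul_shift_add_trunc M P
  let W : PowerSeries (ZMod 2) :=
    R * (1 + PowerSeries.X) ^ 2 *
      ((1 + PowerSeries.X) * (PowerSeries.X ^ M * R - 2 * P) - (A : PowerSeries (ZMod 2)))
  have hform : (thueMorseForm A B : PowerSeries (ZMod 2)) = PowerSeries.X ^ M * W := by
    have hfe : (1 + PowerSeries.X) ^ 3 * G ^ 2 + (1 + PowerSeries.X) ^ 2 * G +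
        PowerSeries.X = 0 := thueMorse_functional_equation he ho
    have hB' : (B : PowerSeries (ZMod 2)) =
        (A : PowerSeries (ZMod 2)) * G - PowerSeries.X ^ M * R := by
      rw [eq_sub_iff_add_eq, add_comm]
      exact hPB.symm
    simp only [thueMorseForm, coe_add, coe_mul, coe_pow, coe_one, coe_X, hB', W, P]
    linear_combination (A : PowerSeries (ZMod 2)) ^ 2 * hfe
  refine ⟨A, B, ?_, hA, hB, fun i hi => ?_, ?_⟩
  · rintro h
    simp [h] at hA0
  · rw [← coeff_coe, hform, PowerSeries.coeff_X_pow_mul', if_neg (by omega)]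
  · rw [← coeff_coe, hform, show n + (l + 1) = 0 + M by omega, PowerSeries.coeff_X_pow_mul,
      PowerSeries.coeff_zero_eq_constantCoeff_apply]
    have hM : M ≠ 0 := by omega
    have hR : PowerSeries.constantCoeff R = t M + ∑ i, c i * t (n + i) := by
      rw [← PowerSeries.coeff_zero_eq_constantCoeff_apply, PowerSeries.coeff_mk, zero_add, hP]
    have hG : PowerSeries.constantCoeff G = 0 := by
      rw [← PowerSeries.coeff_zero_eq_constantCoeff_apply, PowerSeries.coeff_mk, h0]
    have hAc : PowerSeries.constantCoeff (A : PowerSeries (ZMod 2)) = 1 := by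
      rw [← PowerSeries.coeff_zero_eq_constantCoeff_apply, coeff_coe, hA0]
    simp [W, P, hR, hG, hAc, hM]

lemma thueMorse_one (h0 : t 0 = 0) (ho : ∀ n, t (2 * n + 1) = t n + 1) : t 1 = 1 := by
  simpa [h0] using ho 0

lemma SatisfiesRecurrence.le_of_thueMorse (h0 : t 0 = 0) (he : ∀ n, t (2 * n) = t n)
    (ho : ∀ n, t (2 * n + 1) = t n + 1) {L N : ℕ} (h : SatisfiesRecurrence t L N) :
    N ≤ 2 * L + 1 := by
  by_contra! hN
  obtain ⟨c, hc⟩ := h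
  rcases L with _ | l
  · simpa [thueMorse_one h0 ho] using hc 1 (by omega)
  · obtain ⟨A, B, hA0, hA, hB, hlow, -⟩ :=
      exists_thueMorseForm_eq h0 he ho (n := l + 3) c fun m hm => hc m (by omega)
    refine hA0 (eq_zero_of_thueMorseForm_eq_zero hA hB ?_)
    ext i
    rcases Nat.lt_or_ge i (l + 3 + (l + 1)) with hi | hi
    · exact hlow i hi
    · exact Polynomial.coeff_eq_zero_of_natDegree_lt
        ((natDegree_thueMorseForm_le hA hB).trans_lt (by omega))

lemma SatisfiesRecurrence.succ_of_thueMorse (h0 : t 0 = 0) (he : ∀ n, t (2 * n) = t n)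
    (ho : ∀ n, t (2 * n + 1) = t n + 1) {l : ℕ}
    (h : SatisfiesRecurrence t (l + 1) (2 * (l + 1))) :
    SatisfiesRecurrence t (l + 1) (2 * (l + 1) + 1) := by
  obtain ⟨c, hc⟩ := h
  refine ⟨c, fun n hn => ?_⟩
  rcases Nat.lt_or_ge n (l + 1) with hn' | hn'
  · exact hc n (by omega)
  obtain rfl : n = l + 1 := by omega
  obtain ⟨A, B, -, hA, hB, hlow, hcoeff⟩ :=
    exists_thueMorseForm_eq h0 he ho (n := l + 1) c fun m hm => hc m (by omega)
  have h := coeff_thueMorseForm_eq_zero hA hB fun i hi => hlow i (by omega)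
  rw [two_mul, hcoeff] at h
  exact CharTwo.add_eq_zero.1 h

lemma not_satisfiesRecurrence_thueMorse_succ (h0 : t 0 = 0) (he : ∀ n, t (2 * n) = t n)
    (ho : ∀ n, t (2 * n + 1) = t n + 1) {d : ℕ} (h : SatisfiesRecurrence t d (2 * d + 1)) :
    ¬ SatisfiesRecurrence t (d + 1) (2 * (d + 1) + 1) := by
  rintro ⟨c', hc'⟩
  obtain ⟨c, hc⟩ := h
  have hfail : t (d + 1 + d) ≠ ∑ i, c i * t (d + 1 + i) := by
    intro hd
    have : SatisfiesRecurrence t d (2 * d + 2) := by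
      refine ⟨c, fun n hn => ?_⟩
      rcases Nat.lt_or_ge n (d + 1) with h | h
      · exact hc n (by omega)
      · obtain rfl : n = d + 1 := by omega
        exact hd
    exact absurd (this.le_of_thueMorse h0 he ho) (by omega)
  apply hfail
  have hswap : ∑ j : Fin (d + 1), c' j * ∑ i, c i * t (j + i) =
      ∑ i, c i * ∑ j : Fin (d + 1), c' j * t (i + j) := by
    simp_rw [Finset.mul_sum]
    rw [Finset.sum_comm]
    refine Finset.sum_congr rfl fun i _ => Finset.sum_congr rfl fun j _ => ?_
    rw [add_comm (i : ℕ)]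
    ring
  calc t (d + 1 + d) = t (d + (d + 1)) := by rw [add_comm]
    _ = ∑ j, c' j * t (d + j) := hc' d (by omega)
    _ = ∑ j : Fin (d + 1), c' j * ∑ i, c i * t (j + i) := by
      refine Finset.sum_congr rfl fun j _ => ?_
      rw [← hc j (by omega), add_comm]
    _ = ∑ i, c i * ∑ j : Fin (d + 1), c' j * t (i + j) := hswap
    _ = ∑ i, c i * t (d + 1 + i) := by
      refine Finset.sum_congr rfl fun i _ => ?_
      rw [← hc' i (by omega), add_comm]

lemma satisfiesRecurrence_thueMorse_iff_even (h0 : t 0 = 0) (he : ∀ n, t (2 * n) = t n)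
    (ho : ∀ n, t (2 * n + 1) = t n + 1) (d : ℕ) :
    SatisfiesRecurrence t d (2 * d + 1) ↔ Even d := by
  induction d with
  | zero =>
    refine iff_of_true ⟨0, fun n hn => ?_⟩ Even.zero
    obtain rfl : n = 0 := by omega
    simpa using h0
  | succ d ih =>
    rw [Nat.even_add_one, ← ih]
    refine ⟨fun h h' => not_satisfiesRecurrence_thueMorse_succ h0 he ho h' h, fun h => ?_⟩
    obtain ⟨e, hed, hrec⟩ := exists_satisfiesRecurrence t (d + 1)
    have hle := hrec.le_of_thueMorse h0 he ho
    obtain rfl | rfl : e = d ∨ e = d + 1 := by omega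
    · exact absurd (hrec.mono (by omega)) h
    · exact SatisfiesRecurrence.succ_of_thueMorse h0 he ho (hrec.mono (by omega))

end ThueMorse

theorem thueMorse_linearComplexity (t : ℕ → ZMod 2) (h0 : t 0 = 0)
    (he : ∀ n, t (2 * n) = t n) (ho : ∀ n, t (2 * n + 1) = t n + 1)
    (N : ℕ) (hN : 1 ≤ N) :
    linearComplexity t N = 2 * ((N + 2) / 4) := by
  have hiff := satisfiesRecurrence_thueMorse_iff_even h0 he ho
  have hmem : SatisfiesRecurrence t (2 * ((N + 2) / 4)) N :=
    ((hiff _).2 (even_two_mul _)).mono (by omega)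
  refine le_antisymm (Nat.sInf_le hmem) (le_csInf ⟨_, hmem⟩ fun L hL => ?_)
  replace hL : SatisfiesRecurrence t L N := hL
  have hle := hL.le_of_thueMorse h0 he ho
  by_contra! hlt
  obtain ⟨k, hk⟩ : ∃ k, (N + 2) / 4 = k + 1 := ⟨(N + 2) / 4 - 1, by omega⟩
  obtain rfl : L = 2 * k + 1 := by omega
  have := (hiff _).1 (SatisfiesRecurrence.succ_of_thueMorse h0 he ho (hL.mono (by omega)))
  exact Nat.not_even_two_mul_add_one k this
end

section
/- Let p be a prime, 1 ≤ a < p^k, and let G(t) ∈ F_p[[t]] be the generating function of the pattern sequence (r_n). Then (t−1)^{p^k}·G(t) = (t−1)^{p^k + p − 1}·G(t)^p − t^a in F_p[[t]]. -/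
open PowerSeries

theorem PowerSeries.pow_char_eq_expand {p : ℕ} [Fact p.Prime] (hp : p ≠ 0)
    (f : PowerSeries (ZMod p)) : f ^ p = f.expand p hp := by
  have h := MvPowerSeries.map_frobenius_expand p hp (f := f)
  rw [ZMod.frobenius_zmod, MvPowerSeries.map_id] at h
  exact h.symm

theorem PowerSeries.geom_sum_mul_expand {R : Type*} [CommRing R] {p : ℕ} (hp : p ≠ 0)
    (f : PowerSeries R) :
    (∑ i ∈ Finset.range p, (X : PowerSeries R) ^ i) * f.expand p hp =
      PowerSeries.mk fun n => coeff (n / p) f := by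
  have hpos : 0 < p := Nat.pos_of_ne_zero hp
  ext n
  rw [Finset.sum_mul, map_sum, coeff_mk, Finset.sum_eq_single (n % p)]
  · rw [coeff_X_pow_mul', if_pos (Nat.mod_le n p)]
    have h : n - n % p = p * (n / p) := by have := Nat.mod_add_div n p; omega
    rw [h, coeff_expand_mul]
  · intro i hi hne
    rw [coeff_X_pow_mul']
    split_ifs with hin
    · refine coeff_expand_of_not_dvd p hp f fun hdvd => hne ?_
      rw [← Nat.mod_eq_of_lt (Finset.mem_range.mp hi)]
      exact (Nat.modEq_iff_dvd' hin).mpr hdvd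
    · rfl
  · exact fun h => absurd (Finset.mem_range.mpr (Nat.mod_lt n hpos)) h

theorem PowerSeries.X_pow_sub_one_mul_mk_mod_eq {R : Type*} [CommRing R] {q a : ℕ}
    (haq : a < q) :
    ((X : PowerSeries R) ^ q - 1) * (PowerSeries.mk fun n => if n % q = a then 1 else 0) =
      -X ^ a := by
  ext n
  rw [sub_mul, one_mul, map_sub, coeff_X_pow_mul', map_neg, coeff_X_pow, coeff_mk]
  by_cases hqn : q ≤ n
  · rw [if_pos hqn, coeff_mk, ← Nat.mod_eq_sub_mod hqn, if_neg (by omega : n ≠ a)]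
    simp
  · rw [if_neg hqn, coeff_mk, Nat.mod_eq_of_lt (not_le.mp hqn), zero_sub]

/-- The functional equation `(t-1)^(p^k) G(t) = (t-1)^(p^k+p-1) G(t)^p - t^a` for the
generating function `G` of the pattern sequence. -/
theorem patternSequence_generatingFunction_eq (p k a : ℕ) [Fact p.Prime]
    (hk : 1 ≤ k) (ha : 1 ≤ a) (hak : a < p ^ k)
    (r : ℕ → ZMod p) (hr0 : r 0 = 0)
    (hrec : ∀ n, 1 ≤ n → r n = r (n / p) + if n % p ^ k = a then 1 else 0)
    (G : PowerSeries (ZMod p)) (hG : G = PowerSeries.mk r) :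
    (PowerSeries.X - 1) ^ p ^ k * G =
      (PowerSeries.X - 1) ^ (p ^ k + p - 1) * G ^ p - PowerSeries.X ^ a := by
  have hp : p.Prime := Fact.out
  have : CharP (PowerSeries (ZMod p)) p :=
    charP_of_injective_algebraMap (algebraMap (ZMod p) (PowerSeries (ZMod p))).injective p
  have hgeom : (X - 1 : PowerSeries (ZMod p)) ^ (p - 1) = ∑ i ∈ Finset.range p, X ^ i := by
    have hX : (X - 1 : PowerSeries (ZMod p)) ≠ 0 := fun h => by
      simpa using congrArg constantCoeff h
    refine mul_right_cancel₀ hX ?_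
    rw [geom_sum_mul, ← pow_succ, Nat.sub_add_cancel hp.one_le, sub_pow_char, one_pow]
  have hsplit : G = (X - 1) ^ (p - 1) * G ^ p +
      PowerSeries.mk fun n => if n % p ^ k = a then 1 else 0 := by
    rw [hgeom, PowerSeries.pow_char_eq_expand hp.ne_zero, PowerSeries.geom_sum_mul_expand, hG]
    ext n
    simp only [map_add, coeff_mk]
    rcases Nat.eq_zero_or_pos n with rfl | hn
    · simp [hr0, (Nat.one_le_iff_ne_zero.mp ha).symm]
    · exact hrec n hn
  have hfrob : (X - 1 : PowerSeries (ZMod p)) ^ p ^ k = X ^ p ^ k - 1 := by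
    rw [sub_pow_char_pow, one_pow]
  rw [Nat.add_sub_assoc hp.one_le, pow_add, mul_assoc, sub_eq_add_neg _ (X ^ a),
    ← PowerSeries.X_pow_sub_one_mul_mk_mod_eq hak, ← hfrob, ← mul_add, ← hsplit]
end

section
/- Let p be a prime and a,k integers with 1 ≤ a < p^k. The polynomial h(s,t) = (t−1)^{p^k+p−1}·s^p − (t−1)^{p^k}·s − t^a ∈ F_p[s,t], viewed as a polynomial in s, has no zero in the rational function field F_p(t); that is, there are no coprime polynomials g,f ∈ F_p[t] with f ≠ 0 such that (t−1)^{p^k+p−1}·g^p − (t−1)^{p^k}·g·f^{p−1} − t^a·f^p = 0. -/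
open Polynomial

/-- The polynomial `h(s,t) = (t-1)^(p^k+p-1) s^p - (t-1)^(p^k) s - t^a` has no zero in the
rational function field `F_p(t)`: there are no coprime polynomials `g, f` with `f ≠ 0` such
that `(t-1)^(p^k+p-1) g^p - (t-1)^(p^k) g f^(p-1) - t^a f^p = 0`. -/
theorem patternSequence_polynomial_no_rational_zero (p k a : ℕ) [Fact p.Prime]
    (hk : 1 ≤ k) (ha : 1 ≤ a) (hak : a < p ^ k) :
    ¬ ∃ g f : Polynomial (ZMod p), IsCoprime g f ∧ f ≠ 0 ∧
      (Polynomial.X - 1) ^ (p ^ k + p - 1) * g ^ p -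
        (Polynomial.X - 1) ^ p ^ k * g * f ^ (p - 1) - Polynomial.X ^ a * f ^ p = 0 := by
  rintro ⟨g, f, hgf, hf, h⟩
  have hp : p.Prime := Fact.out
  have hq : p ∣ p ^ k := dvd_pow_self p (by lia)
  have hq2 : 2 ≤ p ^ k := hp.two_le.trans (Nat.le_of_dvd (pow_pos hp.pos k) hq)
  generalize p ^ k = q at *
  have hu : Prime (X - 1 : (ZMod p)[X]) := by simpa using prime_X_sub_C (1 : ZMod p)
  have huX : ¬ (X - 1 : (ZMod p)[X]) ∣ X ^ a := fun hd => by
    have := dvd_iff_isRoot.mp (show (X - C (1 : ZMod p)) ∣ X ^ a by simpa using hd)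
    simp at this
  obtain ⟨f', hff', hf'⟩ :=
    (FiniteMultiplicity.of_prime_left hu hf).exists_eq_pow_mul_and_not_dvd
  generalize multiplicity (X - 1) f = m at hff'
  subst hff'
  generalize (X - 1 : (ZMod p)[X]) = u at *
  have hXf : ¬ u ∣ X ^ a * f' ^ p := fun hd =>
    (hu.dvd_or_dvd hd).elim huX fun h => hf' (hu.dvd_of_dvd_pow h)
  obtain ⟨r, rfl⟩ : ∃ r, p = r + 1 := ⟨p - 1, by have := hp.pos; lia⟩
  have hr : 1 ≤ r := by have := hp.two_le; lia
  have hN : q + (r + 1) - 1 = q + r := by lia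
  rw [hN, Nat.add_sub_cancel] at h
  rcases lt_trichotomy ((r + 1) * m) (q + r) with hlt | heq | hgt
  · have hmq : m < q := by nlinarith
    obtain ⟨d, hd⟩ : ∃ d, q + r = (r + 1) * m + (d + 1) :=
      Nat.exists_eq_add_of_lt hlt
    obtain ⟨e, he⟩ : ∃ e, q = m + (e + 1) := Nat.exists_eq_add_of_lt hmq
    rw [hd, he] at h
    refine hXf ⟨u ^ d * g ^ (r + 1) - u ^ e * g * f' ^ r, ?_⟩
    refine mul_left_cancel₀ (pow_ne_zero ((r + 1) * m) hu.ne_zero) ?_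
    linear_combination -h
  · have : r + 1 ∣ q + r := ⟨m, heq.symm⟩
    have := (Nat.dvd_add_right hq).mp this
    have := Nat.le_of_dvd hr this
    lia
  · have hm2 : 2 ≤ m := by
      by_contra!
      have : (r + 1) * m ≤ (r + 1) * 1 := Nat.mul_le_mul_left _ (by lia)
      lia
    have hug : ¬ u ∣ g := fun hd => hu.not_isUnit <|
      hgf.isUnit_of_dvd' hd (Dvd.dvd.mul_right (dvd_pow_self u (by lia)) f')
    obtain ⟨n, rfl⟩ : ∃ n, m = n + 2 := ⟨m - 2, by lia⟩
    obtain ⟨s, rfl⟩ : ∃ s, r = s + 1 := ⟨r - 1, by lia⟩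
    obtain ⟨d, hd⟩ : ∃ d, (s + 1 + 1) * (n + 2) = q + (s + 1) + (d + 1) :=
      Nat.exists_eq_add_of_lt hgt
    have hfp : (u ^ (n + 2) * f') ^ (s + 1 + 1) =
        u ^ (q + (s + 1) + (d + 1)) * f' ^ (s + 1 + 1) := by
      rw [mul_pow, ← pow_mul, mul_comm (n + 2), hd]
    rw [hfp] at h
    refine hug (hu.dvd_of_dvd_pow (n := s + 1 + 1)
      ⟨u ^ ((s + 1) * n + s) * g * f' ^ (s + 1) + X ^ a * u ^ d * f' ^ (s + 1 + 1), ?_⟩)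
    refine mul_left_cancel₀ (pow_ne_zero (q + (s + 1)) hu.ne_zero) ?_
    linear_combination h
end

section
/- Let p be a prime and let G(t) ∈ F_p[[t]] be the generating function of the sum-of-digits sequence (s_n) modulo p. Then (1−t)^{p+1}·G(t)^p − (1−t)^2·G(t) + t = 0 in F_p[[t]], and moreover the polynomial h(s,t) = (1−t)^{p+1}s^p − (1−t)^2 s + t, viewed as a polynomial in s, has no zero in the rational function field F_p(t). -/
open PowerSeries in
/-- Over the prime field, the `p`-th power of a power series is its expansion by `p`. -/
theorem PowerSeries.expand_zmod_card (p : ℕ) [hp : Fact p.Prime] (f : PowerSeries (ZMod p)) :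
    expand p hp.out.ne_zero f = f ^ p := by
  have h := MvPowerSeries.map_frobenius_expand p hp.out.ne_zero (f := f)
  rw [ZMod.frobenius_zmod, MvPowerSeries.map_id] at h
  exact h

open PowerSeries in
/-- The series with coefficients `s (n / p)`, multiplied by `1 - X`, is the `p`-th power of
`(1 - X) * mk s`. -/
theorem PowerSeries.one_sub_X_mul_mk_div (p : ℕ) [hp : Fact p.Prime] (s : ℕ → ZMod p) :
    (1 - X) * mk (fun n => s (n / p)) = ((1 - X) * mk s) ^ p := by
  rw [← expand_zmod_card]
  ext n
  rw [coeff_expand]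
  cases n with
  | zero => simp [sub_mul]
  | succ n =>
    split_ifs with h
    · simp [sub_mul, coeff_succ_X_mul, Nat.succ_div_of_dvd h]
    · simp [sub_mul, coeff_succ_X_mul, Nat.succ_div_of_not_dvd h]

open PowerSeries in
theorem PowerSeries.one_sub_X_sq_mul_mk_natCast (R : Type*) [CommRing R] :
    (1 - X) ^ 2 * mk (fun n => (n : R)) = X := by
  have h : (1 - X) * mk (fun n => (n : R)) = X * mk 1 := by
    ext n
    cases n <;> simp [sub_mul, coeff_succ_X_mul]
  rw [sq, mul_assoc, h, mul_left_comm, mul_comm (1 - X), mk_one_mul_one_sub_eq_one, mul_one]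

open Polynomial in
/-- The rational function `X / (1 - X)` has a simple pole, so it is not of the form `w - w ^ p`. -/
theorem RatFunc.one_sub_X_mul_pow_sub_add_X_ne_zero {K : Type*} [Field K] {p : ℕ} (hp : 2 ≤ p)
    (w : RatFunc K) : (1 - RatFunc.X) * (w ^ p - w) + RatFunc.X ≠ 0 := by
  intro h
  obtain ⟨m, rfl⟩ : ∃ m, p = m + 2 := ⟨p - 2, by omega⟩
  have hb : algebraMap K[X] (RatFunc K) w.denom ≠ 0 :=
    RatFunc.algebraMap_ne_zero w.denom_ne_zero
  have key : (1 - Polynomial.X) * (w.num ^ (m + 2) - w.num * w.denom ^ (m + 1)) +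
      Polynomial.X * w.denom ^ (m + 2) = 0 := by
    apply RatFunc.algebraMap_injective K
    have hw := RatFunc.num_div_denom w
    rw [eq_comm, eq_div_iff hb] at hw
    simp only [map_add, map_mul, map_sub, map_pow, map_one, map_zero, RatFunc.algebraMap_X, ← hw]
    linear_combination (algebraMap K[X] (RatFunc K) w.denom) ^ (m + 2) * h
  have hdenom : w.denom.eval 1 = 0 := by
    simpa using congrArg (Polynomial.eval 1) key
  obtain ⟨c, hc⟩ := dvd_iff_isRoot.mpr hdenom
  have hX : (Polynomial.X - 1 : K[X]) ≠ 0 := by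
    simpa using X_sub_C_ne_zero (1 : K)
  have key' : w.num ^ (m + 2) - w.num * w.denom ^ (m + 1) =
      Polynomial.X * ((Polynomial.X - 1) ^ (m + 1) * c ^ (m + 2)) := by
    apply mul_left_cancel₀ hX
    rw [map_one] at hc
    have : w.denom ^ (m + 2) =
        (Polynomial.X - 1) * ((Polynomial.X - 1) ^ (m + 1) * c ^ (m + 2)) := by
      rw [hc, mul_pow]; ring
    linear_combination Polynomial.X * this - key
  have hnum : w.num.eval 1 = 0 := by
    simpa [hdenom] using congrArg (Polynomial.eval 1) key'
  obtain ⟨u, v, huv⟩ := w.isCoprime_num_denom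
  simpa [hnum, hdenom] using congrArg (Polynomial.eval 1) huv

/-- The generating function `G` of the sum-of-digits sequence modulo `p` satisfies
`(1-t)^(p+1) G^p - (1-t)^2 G + t = 0`, and the polynomial
`h(s,t) = (1-t)^(p+1) s^p - (1-t)^2 s + t` has no zero in `F_p(t)`. -/
theorem sumOfDigits_generatingFunction (p : ℕ) [Fact p.Prime]
    (s : ℕ → ZMod p) (hs0 : s 0 = 0)
    (hrec : ∀ n, 1 ≤ n → s n = s (n / p) + (n : ZMod p))
    (G : PowerSeries (ZMod p)) (hG : G = PowerSeries.mk s) :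
    (1 - PowerSeries.X) ^ (p + 1) * G ^ p - (1 - PowerSeries.X) ^ 2 * G + PowerSeries.X = 0 ∧
      ∀ r : RatFunc (ZMod p),
        (1 - RatFunc.X) ^ (p + 1) * r ^ p - (1 - RatFunc.X) ^ 2 * r + RatFunc.X ≠ 0 := by
  refine ⟨?_, fun r h => ?_⟩
  · subst hG
    have hsum : PowerSeries.mk s =
        PowerSeries.mk (fun n => s (n / p)) + PowerSeries.mk (fun n => (n : ZMod p)) := by
      ext n
      rcases Nat.eq_zero_or_pos n with rfl | hn
      · simp [hs0]
      · simpa using hrec n hn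
    have hdiv := PowerSeries.one_sub_X_mul_mk_div p s
    have hnat := PowerSeries.one_sub_X_sq_mul_mk_natCast (ZMod p)
    rw [mul_pow] at hdiv
    linear_combination (-(1 - PowerSeries.X)) * hdiv - (1 - PowerSeries.X) ^ 2 * hsum - hnat
  · apply RatFunc.one_sub_X_mul_pow_sub_add_X_ne_zero (Fact.out : p.Prime).two_le
      ((1 - RatFunc.X) * r)
    rw [mul_pow]
    linear_combination h
end

section
/- Let G(t) ∈ F_2[[t]] be the generating function of the Baum–Sweet sequence (b_n). Then G(t)^3 + t·G(t) + 1 = 0, and G(t) is the unique power series root of the polynomial h(s,t) = s^3 + t·s + 1 over F_2; in particular h(s,t), viewed as a polynomial in s, has no zero in F_2(t). -/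
/-- The Frobenius on power series over `ZMod p` is the substitution `X ↦ X ^ p`. -/
theorem PowerSeries.pow_eq_expand_zmod (p : ℕ) [hp : Fact p.Prime] (f : PowerSeries (ZMod p)) :
    f ^ p = f.expand p hp.out.ne_zero := by
  have h := MvPowerSeries.map_frobenius_expand p hp.out.ne_zero (R := ZMod p) (f := f)
  rw [ZMod.frobenius_zmod, MvPowerSeries.map_id] at h
  exact h.symm

/-- The functional equation of the generating function of a Baum--Sweet sequence. -/
theorem baumSweet_mk_eq_expand (b : ℕ → ZMod 2) (hodd : ∀ n, b (2 * n + 1) = b n)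
    (hfour : ∀ n, b (4 * n) = b n) (hmod : ∀ n, b (4 * n + 2) = 0) :
    PowerSeries.mk b = (PowerSeries.mk b).expand 4 four_ne_zero +
      PowerSeries.X * (PowerSeries.mk b).expand 2 two_ne_zero := by
  ext n
  obtain ⟨k, rfl | rfl⟩ := Nat.even_or_odd' n
  · have hX : PowerSeries.coeff (2 * k)
        (PowerSeries.X * (PowerSeries.mk b).expand 2 two_ne_zero) = 0 := by
      cases k with
      | zero => simp
      | succ k =>
        rw [show 2 * (k + 1) = (2 * k + 1) + 1 by ring, PowerSeries.coeff_succ_X_mul,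
          PowerSeries.coeff_expand_of_not_dvd 2 two_ne_zero _ (by omega)]
    rw [map_add, hX, add_zero]
    obtain ⟨j, rfl | rfl⟩ := Nat.even_or_odd' k
    · rw [show 2 * (2 * j) = 4 * j by ring, PowerSeries.coeff_expand_mul]
      simp [hfour]
    · rw [show 2 * (2 * j + 1) = 4 * j + 2 by ring,
        PowerSeries.coeff_expand_of_not_dvd 4 four_ne_zero _ (by omega), PowerSeries.coeff_mk, hmod]
  · rw [map_add, PowerSeries.coeff_expand_of_not_dvd 4 four_ne_zero _ (by omega),
      PowerSeries.coeff_succ_X_mul, PowerSeries.coeff_expand_mul]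
    simp [hodd]

/-- The polynomial `s ^ 3 + t * s + 1` has at most one power series root over `F_2`. -/
theorem PowerSeries.eq_of_cube_add_X_mul_add_one_eq_zero {F H : PowerSeries (ZMod 2)}
    (hF : F ^ 3 + X * F + 1 = 0) (hH : H ^ 3 + X * H + 1 = 0) : H = F := by
  have hconst : ∀ K : PowerSeries (ZMod 2), K ^ 3 + X * K + 1 = 0 → constantCoeff K = 1 := by
    intro K hK
    have h := congrArg constantCoeff hK
    simp only [map_add, map_pow, map_mul, constantCoeff_X, zero_mul, add_zero, map_one,
      map_zero] at h
    generalize constantCoeff K = c at h ⊢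
    revert c
    decide
  have hprod : (H - F) * (H ^ 2 + H * F + F ^ 2 + X) = 0 := by linear_combination hH - hF
  refine sub_eq_zero.mp ((mul_eq_zero.mp hprod).resolve_right fun h ↦ ?_)
  have h' := congrArg constantCoeff h
  simp only [map_add, map_pow, map_mul, constantCoeff_X, hconst F hF, hconst H hH, map_zero] at h'
  revert h'
  decide

/-- The polynomial `s ^ 3 + t * s + 1` has no root in the rational function field `F_2(t)`. -/
theorem RatFunc.cube_add_X_mul_add_one_ne_zero (r : RatFunc (ZMod 2)) :
    r ^ 3 + X * r + 1 ≠ 0 := by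
  intro hr
  have hint : IsIntegral (Polynomial (ZMod 2)) r := by
    refine ⟨Polynomial.X ^ 3 + Polynomial.C Polynomial.X * Polynomial.X + 1, by monicity!, ?_⟩
    simpa using hr
  obtain ⟨p, rfl⟩ := IsIntegrallyClosed.isIntegral_iff.mp hint
  rw [← RatFunc.algebraMap_X, ← map_pow, ← map_mul, ← map_add,
    ← map_one (algebraMap (Polynomial (ZMod 2)) (RatFunc (ZMod 2))),
    ← map_add, map_eq_zero_iff _ (RatFunc.algebraMap_injective _)] at hr
  have h := congrArg (Polynomial.eval 1) hr
  simp only [Polynomial.eval_add, Polynomial.eval_pow, Polynomial.eval_mul, Polynomial.eval_X,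
    Polynomial.eval_one, Polynomial.eval_zero, one_mul] at h
  generalize Polynomial.eval 1 p = c at h
  revert c
  decide

/-- The generating function `G` of the Baum--Sweet sequence satisfies `G^3 + t G + 1 = 0`,
it is the unique power series root of `h(s,t) = s^3 + t s + 1` over `F_2`, and `h` has no
zero in the rational function field `F_2(t)`. -/
theorem baumSweet_generatingFunction (b : ℕ → ZMod 2) (hb0 : b 0 = 1)
    (hrec : ∀ c m : ℕ, 1 ≤ m → ¬ (4 ∣ m) →
      b (4 ^ c * m) = if m % 2 = 0 then 0 else b ((m - 1) / 2))
    (G : PowerSeries (ZMod 2)) (hG : G = PowerSeries.mk b) :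
    G ^ 3 + PowerSeries.X * G + 1 = 0 ∧
      (∀ H : PowerSeries (ZMod 2), H ^ 3 + PowerSeries.X * H + 1 = 0 → H = G) ∧
      ∀ r : RatFunc (ZMod 2), r ^ 3 + RatFunc.X * r + 1 ≠ 0 := by
  have hodd (n : ℕ) : b (2 * n + 1) = b n := by
    have h := hrec 0 (2 * n + 1) (by omega) (by omega)
    rwa [pow_zero, one_mul, if_neg (by omega), show (2 * n + 1 - 1) / 2 = n by omega] at h
  have hmod (n : ℕ) : b (4 * n + 2) = 0 := by
    have h := hrec 0 (4 * n + 2) (by omega) (by omega)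
    rwa [pow_zero, one_mul, if_pos (by omega)] at h
  have hfour (n : ℕ) : b (4 * n) = b n := by
    obtain rfl | hn := eq_or_ne n 0
    · rfl
    obtain ⟨c, m, hm, rfl⟩ := Nat.exists_eq_pow_mul_and_not_dvd hn 4 (by norm_num)
    have hpos : 1 ≤ m := Nat.one_le_iff_ne_zero.mpr (by rintro rfl; simp at hm)
    rw [← mul_assoc, ← pow_succ', hrec _ m hpos hm, hrec _ m hpos hm]
  have hfun : G = G ^ 4 + PowerSeries.X * G ^ 2 := by
    have hsq := PowerSeries.pow_eq_expand_zmod 2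
    rw [show G ^ 4 = (G ^ 2) ^ 2 by ring, hsq (G ^ 2), hsq G, ← PowerSeries.expand_mul, hG]
    exact baumSweet_mk_eq_expand b hodd hfour hmod
  have hne : G ≠ 0 := by
    rintro rfl
    simpa [hb0] using congrArg (PowerSeries.coeff 0) hG
  have hroot : G ^ 3 + PowerSeries.X * G + 1 = 0 := by
    have htwo : (2 : PowerSeries (ZMod 2)) = 0 := by
      rw [← map_ofNat (PowerSeries.C (R := ZMod 2)) 2, ← map_zero PowerSeries.C]
      exact congrArg PowerSeries.C (CharTwo.two_eq_zero (R := ZMod 2))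
    refine (mul_eq_zero.mp ?_).resolve_left hne
    linear_combination G * htwo - hfun
  exact ⟨hroot, fun H hH ↦ PowerSeries.eq_of_cube_add_X_mul_add_one_eq_zero hroot hH,
    RatFunc.cube_add_X_mul_add_one_ne_zero⟩
end

section
/- Let G(t) ∈ F_2[[t]] be the generating function of the regular paperfolding sequence (v_n) (with arbitrary v_0 ∈ F_2). Then (t^4+1)·G(t)^2 + (t^4+1)·G(t) + t = 0, and the polynomial h(s,t) = (t^4+1)s^2 + (t^4+1)s + t, viewed as a polynomial in s, has no zero in F_2(t). -/
/-- Squaring a power series over `F_2` spreads its coefficients over the even indices. -/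
theorem PowerSeries.sq_eq_expand_zmod_two (f : PowerSeries (ZMod 2)) :
    f ^ 2 = f.expand 2 two_ne_zero := by
  rw [PowerSeries.expand, ← MvPowerSeries.map_frobenius_expand 2 two_ne_zero (f := f),
    ZMod.frobenius_zmod]
  exact congrFun (congrArg DFunLike.coe MvPowerSeries.map_id) _

/-- The generating function of the paperfolding sequence is an Artin-Schreier root of
`∑ t^(4k+1)`. -/
theorem sq_add_self_of_paperfolding (v : ℕ → ZMod 2)
    (hrec : ∀ c m : ℕ, Odd m → v (2 ^ c * m) = if m % 4 = 1 then 1 else 0) :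
    PowerSeries.mk v ^ 2 + PowerSeries.mk v =
      PowerSeries.mk fun n => if n % 4 = 1 then (1 : ZMod 2) else 0 := by
  ext n
  rw [PowerSeries.sq_eq_expand_zmod_two, map_add, PowerSeries.coeff_expand]
  simp only [PowerSeries.coeff_mk]
  split_ifs with h2 h4 h4
  · omega
  · have hv : v (n / 2) = v n := by
      rcases Nat.eq_zero_or_pos n with rfl | hn
      · simp
      · obtain ⟨c, m, hm, hc⟩ := Nat.exists_eq_two_pow_mul_odd (n := n / 2) (by omega)
        have hn' : n = 2 ^ (c + 1) * m := by rw [pow_succ, mul_right_comm, ← hc]; omega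
        rw [hn', hrec _ m hm, ← hn', hc, hrec c m hm]
    rw [hv, CharTwo.add_self_eq_zero]
  · have := hrec 0 n (Nat.odd_iff.mpr (by omega))
    simpa [h4] using this
  · have := hrec 0 n (Nat.odd_iff.mpr (by omega))
    simpa [h4] using this

theorem PowerSeries.X_pow_four_add_one_mul_mk :
    (PowerSeries.X ^ 4 + 1) * (PowerSeries.mk fun n => if n % 4 = 1 then (1 : ZMod 2) else 0) =
      PowerSeries.X := by
  ext n
  rw [add_mul, one_mul, map_add, PowerSeries.coeff_X_pow_mul', PowerSeries.coeff_X]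
  simp only [PowerSeries.coeff_mk]
  split_ifs <;> first | omega | simp [CharTwo.add_self_eq_zero]

/-- The polynomial equation `p^2 + (t+1)^2 p + t = 0` has no solution over `F_2[t]`: its derivative
at `t = 1` reads `1 = 0`. -/
theorem Polynomial.sq_add_X_add_one_sq_mul_add_X_ne_zero (p : Polynomial (ZMod 2)) :
    p ^ 2 + (Polynomial.X + 1) ^ 2 * p + Polynomial.X ≠ 0 := by
  intro h
  have h1 := congrArg (fun q => (Polynomial.derivative q).eval 1) h
  have h2 : (2 : ZMod 2) = 0 := by decide
  simp [Polynomial.derivative_pow, h2, one_add_one_eq_two] at h1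

/-- The equation satisfied by the paperfolding generating function has no root in `F_2(t)`. -/
theorem RatFunc.paperfolding_equation_ne_zero (r : RatFunc (ZMod 2)) :
    (RatFunc.X ^ 4 + 1) * r ^ 2 + (RatFunc.X ^ 4 + 1) * r + RatFunc.X ≠ 0 := by
  intro h
  have h2 : (2 : RatFunc (ZMod 2)) = 0 := CharTwo.two_eq_zero
  have hq : ((RatFunc.X + 1) ^ 2 * r) ^ 2 +
      (RatFunc.X + 1) ^ 2 * ((RatFunc.X + 1) ^ 2 * r) + RatFunc.X = 0 := by
    linear_combination h + (r ^ 2 + r) *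
      (2 * RatFunc.X ^ 3 + 3 * RatFunc.X ^ 2 + 2 * RatFunc.X) * h2
  have hint : IsIntegral (Polynomial (ZMod 2)) ((RatFunc.X + 1) ^ 2 * r) := by
    refine ⟨Polynomial.X ^ 2 + (Polynomial.C ((Polynomial.X + 1) ^ 2) * Polynomial.X +
      Polynomial.C Polynomial.X), ?_, ?_⟩
    · monicity!
    · simpa [RatFunc.algebraMap_X, add_assoc] using hq
  obtain ⟨p, hp⟩ := IsIntegrallyClosed.isIntegral_iff.mp hint
  rw [← hp] at hq
  apply Polynomial.sq_add_X_add_one_sq_mul_add_X_ne_zero p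
  apply RatFunc.algebraMap_injective (ZMod 2)
  simpa [RatFunc.algebraMap_X] using hq

/-- The generating function `G` of the regular paperfolding sequence satisfies
`(t^4+1) G^2 + (t^4+1) G + t = 0`, and `h(s,t) = (t^4+1) s^2 + (t^4+1) s + t` has no zero
in the rational function field `F_2(t)`. -/
theorem paperfolding_generatingFunction (v : ℕ → ZMod 2)
    (hrec : ∀ c m : ℕ, Odd m → v (2 ^ c * m) = if m % 4 = 1 then 1 else 0)
    (G : PowerSeries (ZMod 2)) (hG : G = PowerSeries.mk v) :
    (PowerSeries.X ^ 4 + 1) * G ^ 2 + (PowerSeries.X ^ 4 + 1) * G + PowerSeries.X = 0 ∧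
      ∀ r : RatFunc (ZMod 2),
        (RatFunc.X ^ 4 + 1) * r ^ 2 + (RatFunc.X ^ 4 + 1) * r + RatFunc.X ≠ 0 := by
  subst hG
  refine ⟨?_, RatFunc.paperfolding_equation_ne_zero⟩
  rw [← mul_add, sq_add_self_of_paperfolding v hrec,
    PowerSeries.X_pow_four_add_one_mul_mk]
  ext n
  rw [map_add, map_zero, CharTwo.add_self_eq_zero]
end

section
/- Let (w_n) be the sequence over F_2 defined by w_{2n} = 1 and w_{2n+1} = w_n + 1 for n ≥ 0, and let G(t) be its generating function. Then t(t+1)·G(t)^2 + (t+1)·G(t) + 1 = 0, and (w_n) has a perfect linear complexity profile: L(w_n,N) = ⌊(N+1)/2⌋ for all N ≥ 1. -/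
open PowerSeries in
/-- The generating function of `w` is a root of `t(t+1) Y² + (t+1) Y + 1`. -/
theorem generating_function_equation (w : ℕ → ZMod 2)
    (he : ∀ n, w (2 * n) = 1) (ho : ∀ n, w (2 * n + 1) = w n + 1) :
    (X * (X + 1) * PowerSeries.mk w ^ 2 + (X + 1) * PowerSeries.mk w + 1 :
      PowerSeries (ZMod 2)) = 0 := by
  have hsq : PowerSeries.mk w ^ 2 = PowerSeries.expand 2 two_ne_zero (PowerSeries.mk w) := by
    have h := MvPowerSeries.map_frobenius_expand (R := ZMod 2) (σ := Unit) 2 two_ne_zero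
      (f := PowerSeries.mk w)
    rw [ZMod.frobenius_zmod, MvPowerSeries.map_id] at h
    exact h.symm
  have hone : (X * PowerSeries.mk w ^ 2 + PowerSeries.mk w : PowerSeries (ZMod 2)) =
      PowerSeries.mk 1 := by
    ext n
    obtain ⟨k, rfl | rfl⟩ := n.even_or_odd'
    · cases k with
      | zero => simpa using he 0
      | succ k =>
        rw [map_add, show 2 * (k + 1) = 2 * k + 1 + 1 by ring, coeff_succ_X_mul, hsq,
          coeff_expand_of_not_dvd 2 two_ne_zero _ (by omega)]
        simpa using! he (k + 1)
    · rw [map_add, coeff_succ_X_mul, hsq, coeff_expand_mul, coeff_mk, coeff_mk, ho, ← add_assoc,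
        CharTwo.add_self_eq_zero, zero_add]
      rfl
  have htwo : (2 : PowerSeries (ZMod 2)) = 0 :=
    (map_ofNat (C (R := ZMod 2)) 2).symm.trans
      ((congrArg C CharTwo.two_eq_zero).trans (map_zero C))
  have hgeom := mk_one_mul_one_sub_eq_one (ZMod 2)
  rw [← hone] at hgeom
  linear_combination (1 + X * (X * PowerSeries.mk w ^ 2 + PowerSeries.mk w)) * htwo + hgeom

open Polynomial in
/-- A zero of the form `t(t+1) P² + (t+1) P Q + Q²` over `𝔽₂[t]` has no leading terms. -/
theorem coeff_eq_zero_of_quadratic_form_eq_zero {m : ℕ} {P Q : (ZMod 2)[X]}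
    (hP : P.natDegree ≤ m) (hQ : Q.natDegree ≤ m + 1)
    (h : X * (X + 1) * P ^ 2 + (X + 1) * (P * Q) + Q ^ 2 = 0) :
    P.coeff m = 0 ∧ Q.coeff (m + 1) = 0 := by
  have hXP : (X * P).natDegree ≤ m + 1 := by
    grw [natDegree_mul_le, natDegree_X_le, hP, add_comm]
  have hX1P : ((X + 1) * P).natDegree ≤ m + 1 := by
    have hX : (X + 1 : (ZMod 2)[X]).natDegree ≤ 1 := by compute_degree
    grw [natDegree_mul_le, hX, hP, add_comm]
  have hcoeff : ((X + 1) * P).coeff (m + 1) = P.coeff m := by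
    rw [add_mul, one_mul, coeff_add, coeff_X_mul,
      coeff_eq_zero_of_natDegree_lt (n := m + 1) (by omega), add_zero]
  have hc := congrArg (fun S => S.coeff (m + 1 + (m + 1))) h
  simp only [show X * (X + 1) * P ^ 2 + (X + 1) * (P * Q) + Q ^ 2 =
      (X * P) * ((X + 1) * P) + ((X + 1) * P) * Q + Q * Q by ring, coeff_add,
    coeff_mul_add_eq_of_natDegree_le hXP hX1P, coeff_mul_add_eq_of_natDegree_le hX1P hQ,
    coeff_mul_add_eq_of_natDegree_le hQ hQ, hcoeff, coeff_X_mul, coeff_zero] at hc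
  generalize P.coeff m = p at hc ⊢
  generalize Q.coeff (m + 1) = q at hc ⊢
  revert p q
  decide

open Polynomial in
/-- The form `t(t+1) P² + (t+1) P Q + Q²` is anisotropic over `𝔽₂[t]`. -/
theorem eq_zero_of_quadratic_form_eq_zero {m : ℕ} {P Q : (ZMod 2)[X]}
    (hP : P.natDegree ≤ m) (hQ : Q.natDegree ≤ m + 1)
    (h : X * (X + 1) * P ^ 2 + (X + 1) * (P * Q) + Q ^ 2 = 0) : Q = 0 := by
  have hstep {R : (ZMod 2)[X]} {n : ℕ} (hR : R.natDegree ≤ n + 1) (h0 : R.coeff (n + 1) = 0) :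
      R.natDegree ≤ n := by
    by_contra! hlt
    obtain rfl : R = 0 := leadingCoeff_eq_zero.mp (by
      rwa [leadingCoeff, le_antisymm hR hlt])
    simp at hlt
  induction m with
  | zero =>
    have hP0 : P = 0 := by
      rw [eq_C_of_natDegree_le_zero hP, (coeff_eq_zero_of_quadratic_form_eq_zero hP hQ h).1, C_0]
    simpa [hP0] using h
  | succ m ih =>
    obtain ⟨hp, hq⟩ := coeff_eq_zero_of_quadratic_form_eq_zero hP hQ h
    exact ih (hstep hP hp) (hstep hQ hq)

open PowerSeries in
/-- If `Q G` has no coefficients in degrees `m + 1, …, 2 m + 2`, where `G` is a root of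
`t(t+1) Y² + (t+1) Y + 1` and `Q` has degree at most `m + 1`, then `Q = 0`. -/
theorem eq_zero_of_coeff_mul_eq_zero {G : PowerSeries (ZMod 2)}
    (hG : X * (X + 1) * G ^ 2 + (X + 1) * G + 1 = 0) {m : ℕ} {Q : Polynomial (ZMod 2)}
    (hQ : Q.natDegree ≤ m + 1)
    (h : ∀ i < m + 2, coeff (m + 1 + i) ((Q : PowerSeries (ZMod 2)) * G) = 0) : Q = 0 := by
  set P := trunc (m + 1) ((Q : PowerSeries (ZMod 2)) * G) with hPdef
  have hP : P.natDegree ≤ m := Nat.lt_succ_iff.mp (natDegree_trunc_lt _ m)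
  obtain ⟨R, hR⟩ : (X : PowerSeries (ZMod 2)) ^ (2 * m + 3) ∣
      (Q : PowerSeries (ZMod 2)) * G - P := by
    rw [X_pow_dvd_iff]
    intro d hd
    rw [map_sub, Polynomial.coeff_coe, hPdef, coeff_trunc]
    split_ifs with hlt
    · exact sub_self _
    · rw [sub_zero, ← h (d - (m + 1)) (by omega)]
      congr 2
      omega
  refine eq_zero_of_quadratic_form_eq_zero hP hQ ?_
  set S : Polynomial (ZMod 2) := Polynomial.X * (Polynomial.X + 1) * P ^ 2 +
    (Polynomial.X + 1) * (P * Q) + Q ^ 2 with hS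
  have hform (p q : PowerSeries (ZMod 2)) (hpq : q * G - p = X ^ (2 * m + 3) * R) :
      X ^ (2 * m + 3) ∣ X * (X + 1) * p ^ 2 + (X + 1) * (p * q) + q ^ 2 := by
    refine ⟨-(R * (X * (X + 1) * (p + q * G) + (X + 1) * q)), ?_⟩
    linear_combination q ^ 2 * hG - (X * (X + 1) * (p + q * G) + (X + 1) * q) * hpq
  have hdvd : (X : PowerSeries (ZMod 2)) ^ (2 * m + 3) ∣ (S : PowerSeries (ZMod 2)) := by
    rw [hS]
    push_cast
    exact hform P Q hR
  have hX : (Polynomial.X + 1 : Polynomial (ZMod 2)).natDegree ≤ 1 := by compute_degree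
  have hdeg : S.natDegree ≤ 2 * m + 2 := by
    refine Polynomial.natDegree_add_le_of_degree_le
      (Polynomial.natDegree_add_le_of_degree_le ?_ ?_) ?_
    · grw [Polynomial.natDegree_mul_le, Polynomial.natDegree_mul_le, Polynomial.natDegree_X_le,
        Polynomial.natDegree_pow_le, hX, hP]
      omega
    · grw [Polynomial.natDegree_mul_le, Polynomial.natDegree_mul_le, hX, hP, hQ]
      omega
    · grw [Polynomial.natDegree_pow_le, hQ]
      omega
  ext d
  by_cases hd : d < 2 * m + 3
  · rw [← Polynomial.coeff_coe]
    exact X_pow_dvd_iff.mp hdvd d hd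
  · exact Polynomial.coeff_eq_zero_of_natDegree_lt (by omega)

open PowerSeries in
/-- The Hankel matrices of a root of `t(t+1) Y² + (t+1) Y + 1` have trivial kernel. -/
theorem hankel_kernel_trivial (w : ℕ → ZMod 2)
    (hG : (X * (X + 1) * PowerSeries.mk w ^ 2 + (X + 1) * PowerSeries.mk w + 1 :
      PowerSeries (ZMod 2)) = 0) {k : ℕ} (c : Fin k → ZMod 2)
    (h : ∀ i < k, ∑ j : Fin k, w (i + j) * c j = 0) : c = 0 := by
  obtain _ | _ | m := k
  · exact Subsingleton.elim _ _
  · have hw : w 0 = 1 := by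
      have := congrArg constantCoeff hG
      simp only [map_add, map_mul, map_pow, constantCoeff_X, map_one, map_zero,
        constantCoeff_mk] at this
      generalize w 0 = a at this ⊢
      revert a
      decide
    have := h 0 one_pos
    ext i
    simpa [hw, Fin.fin_one_eq_zero i] using this
  · set Q : Polynomial (ZMod 2) := ∑ j : Fin (m + 2), Polynomial.monomial (m + 1 - j) (c j)
      with hQdef
    have hQ : Q.natDegree ≤ m + 1 := Polynomial.natDegree_sum_le_of_forall_le _ _ fun j _ =>
      (Polynomial.natDegree_monomial_le _).trans (by omega)
    have hQ0 : Q = 0 := by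
      refine eq_zero_of_coeff_mul_eq_zero hG hQ fun i hi => ?_
      rw [← h i hi, hQdef, ← Polynomial.coeToPowerSeries.ringHom_apply, map_sum, Finset.sum_mul,
        map_sum]
      refine Finset.sum_congr rfl fun j _ => ?_
      rw [Polynomial.coeToPowerSeries.ringHom_apply, ← Polynomial.C_mul_X_pow_eq_monomial,
        show m + 1 + i = (i + j) + (m + 1 - j) by omega, Polynomial.coe_mul, Polynomial.coe_C,
        Polynomial.coe_pow, Polynomial.coe_X, mul_assoc, coeff_C_mul, coeff_X_pow_mul, coeff_mk,
        mul_comm]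
    ext j
    have := congrArg (fun p => p.coeff (m + 1 - j)) hQ0
    simp only [hQdef, Polynomial.finsetSum_coeff, Polynomial.coeff_monomial,
      Polynomial.coeff_zero] at this
    rw [Finset.sum_eq_single j] at this
    · simpa using this
    · intro b _ hb
      exact if_neg fun heq => hb (Fin.ext (by omega))
    · simp

/-- A sequence whose Hankel matrices are nonsingular has a perfect linear complexity profile. -/
theorem linearComplexity_eq_of_hankel {F : Type*} [Field F] (u : ℕ → F)
    (hu : ∀ (k : ℕ) (c : Fin k → F), (∀ i < k, ∑ j : Fin k, u (i + j) * c j = 0) → c = 0)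
    (N : ℕ) :
    linearComplexity u N = (N + 1) / 2 := by
  refine le_antisymm (Nat.sInf_le ?_) (le_csInf ⟨N, 0, fun n hn => by omega⟩ ?_)
  · set L := (N + 1) / 2 with hL
    have hinj : Function.Injective
        (Matrix.of fun i j : Fin L => u (i + j)).mulVec := by
      rw [← Matrix.coe_mulVecLin, ← LinearMap.ker_eq_bot, LinearMap.ker_eq_bot']
      intro c hc
      exact hu L c fun i hi => congrFun hc ⟨i, hi⟩
    obtain ⟨c, hc⟩ := Matrix.mulVec_surjective_iff_isUnit.mpr
      (Matrix.mulVec_injective_iff_isUnit.mp hinj) fun i => u (i + L)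
    refine ⟨c, fun n hn => (congrFun hc ⟨n, by omega⟩).symm.trans ?_⟩
    simp only [Matrix.mulVec, dotProduct, Matrix.of_apply, mul_comm]
  · rintro L ⟨c, hc⟩
    by_contra! hlt
    have hzero := hu (L + 1) (Fin.snoc c (-1)) fun i hi => by
      rw [Fin.sum_univ_castSucc]
      simp only [Fin.snoc_castSucc, Fin.snoc_last, Fin.val_castSucc, Fin.val_last]
      rw [hc i (by omega), mul_neg_one, ← sub_eq_add_neg, sub_eq_zero]
      exact Finset.sum_congr rfl fun j _ => mul_comm _ _
    simpa using congrFun hzero (Fin.last L)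

/-- The sequence `w` with `w_{2n} = 1`, `w_{2n+1} = w_n + 1` satisfies
`t(t+1) G^2 + (t+1) G + 1 = 0` and has a perfect linear complexity profile
`L(w,N) = ⌊(N+1)/2⌋`. -/
theorem perfect_profile_sequence (w : ℕ → ZMod 2)
    (he : ∀ n, w (2 * n) = 1) (ho : ∀ n, w (2 * n + 1) = w n + 1)
    (G : PowerSeries (ZMod 2)) (hG : G = PowerSeries.mk w) :
    PowerSeries.X * (PowerSeries.X + 1) * G ^ 2 + (PowerSeries.X + 1) * G + 1 = 0 ∧
      ∀ N, 1 ≤ N → linearComplexity w N = (N + 1) / 2 := by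
  subst hG
  have hG := generating_function_equation w he ho
  exact ⟨hG, fun N _ => linearComplexity_eq_of_hankel w
    (fun _ c => hankel_kernel_trivial w hG c) N⟩
end

section
/- Let k ≥ 1 and let Q ∈ F_2[x] be a polynomial. In the field F_2((x^{-1})) of formal Laurent series in x^{-1}, write Q·U^{2^k} = Σ_{i ≥ −deg Q} b_i x^{-i}, where U = Σ_{i≥0} x^{-i}. Then b_i = b_j for all i,j ≥ 0 with i ≡ j (mod 2^k), and Q ≡ b_1 x^{2^k − 1} + b_2 x^{2^k − 2} + … + b_{2^k} (mod x^{2^k} + 1) in F_2[x]. -/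
noncomputable section

/-- The element `x` of `F₂((x⁻¹))`: the field of formal Laurent series in `x⁻¹` is modelled
as `LaurentSeries (ZMod 2)` whose variable represents `x⁻¹`, so `x` is its inverse.
The coefficient of `x^{-i}` of an element `R` is then `R.coeff i`. -/
def xVar : LaurentSeries (ZMod 2) :=
  ((PowerSeries.X : PowerSeries (ZMod 2)) : LaurentSeries (ZMod 2))⁻¹

/-- `U = ∑_{i ≥ 0} x^{-i} ∈ F₂((x⁻¹))`. -/
def Useries : LaurentSeries (ZMod 2) :=
  ((PowerSeries.mk fun _ => (1 : ZMod 2)) : LaurentSeries (ZMod 2))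

/-- The embedding of `F₂[x]` into `F₂((x⁻¹))`. -/
def polyToLaurent (P : Polynomial (ZMod 2)) : LaurentSeries (ZMod 2) :=
  Polynomial.aeval xVar P

theorem powerSeries_mk_one_pow_two_pow (k : ℕ) :
    (PowerSeries.mk fun _ => (1 : ZMod 2)) ^ 2 ^ k =
      PowerSeries.mk fun m => if 2 ^ k ∣ m then (1 : ZMod 2) else 0 := by
  have hX : ((1 : PowerSeries (ZMod 2)) - PowerSeries.X) ^ 2 ^ k =
      1 - PowerSeries.X ^ 2 ^ k := by
    have : CharP (PowerSeries (ZMod 2)) 2 :=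
      charP_of_injective_algebraMap (algebraMap (ZMod 2) (PowerSeries (ZMod 2))).injective 2
    rw [sub_pow_char_pow, one_pow]
  have hU : (PowerSeries.mk fun _ => (1 : ZMod 2)) ^ 2 ^ k *
      ((1 : PowerSeries (ZMod 2)) - PowerSeries.X ^ 2 ^ k) = 1 := by
    have h : (PowerSeries.mk fun _ => (1 : ZMod 2)) * (1 - PowerSeries.X) = 1 :=
      PowerSeries.mk_one_mul_one_sub_eq_one (ZMod 2)
    rw [← hX, ← mul_pow, h, one_pow]
  have hV : (PowerSeries.mk fun m => if 2 ^ k ∣ m then (1 : ZMod 2) else 0) *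
      ((1 : PowerSeries (ZMod 2)) - PowerSeries.X ^ 2 ^ k) = 1 := by
    ext m
    rw [mul_sub, mul_one, map_sub, PowerSeries.coeff_mul_X_pow', PowerSeries.coeff_one]
    simp only [PowerSeries.coeff_mk]
    rcases le_or_gt (2 ^ k) m with h | h
    · have hm : m ≠ 0 := by have := Nat.two_pow_pos k; omega
      simp [h, hm, Nat.dvd_sub_iff_left h dvd_rfl]
    · by_cases hm : m = 0
      · simp [hm]
      · have := Nat.not_dvd_of_pos_of_lt (Nat.pos_of_ne_zero hm) h
        simp [hm, this, Nat.not_le.mpr h]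
  exact mul_right_cancel₀ (right_ne_zero_of_mul_eq_one hU) (hU.trans hV.symm)

theorem coeff_xVar_pow_mul (j : ℕ) (f : LaurentSeries (ZMod 2)) (i : ℤ) :
    (xVar ^ j * f).coeff i = f.coeff (i + j) := by
  have h : xVar ^ j = HahnSeries.single (-(j : ℤ)) (1 : ZMod 2) := by
    rw [xVar, PowerSeries.coe_X, HahnSeries.inv_single, inv_one, HahnSeries.single_pow]
    simp
  rw [h, HahnSeries.coeff_single_mul, one_mul, sub_neg_eq_add]

theorem coeff_polyToLaurent_monomial_mul (k j i : ℕ) (a : ZMod 2) :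
    (polyToLaurent (Polynomial.monomial j a) * Useries ^ 2 ^ k).coeff (i : ℤ) =
      if 2 ^ k ∣ i + j then a else 0 := by
  have hC : algebraMap (ZMod 2) (LaurentSeries (ZMod 2)) = HahnSeries.C := Subsingleton.elim _ _
  rw [polyToLaurent, Polynomial.aeval_monomial, hC, mul_assoc, HahnSeries.C_mul_eq_smul,
    HahnSeries.coeff_smul, coeff_xVar_pow_mul, Useries, ← PowerSeries.coe_pow,
    powerSeries_mk_one_pow_two_pow, ← Nat.cast_add, PowerSeries.coeff_coe,
    if_neg (Int.natCast_nonneg _).not_gt, Int.natAbs_natCast, PowerSeries.coeff_mk, smul_eq_mul,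
    mul_ite, mul_one, mul_zero]

theorem coeff_polyToLaurent_add_mul (P Q : Polynomial (ZMod 2)) (f : LaurentSeries (ZMod 2))
    (i : ℤ) : (polyToLaurent (P + Q) * f).coeff i =
      (polyToLaurent P * f).coeff i + (polyToLaurent Q * f).coeff i := by
  simp [polyToLaurent, add_mul]

theorem X_pow_add_one_dvd_X_pow_sub_X_pow_mod (n j : ℕ) :
    (Polynomial.X ^ n + 1 : Polynomial (ZMod 2)) ∣
      Polynomial.X ^ j - Polynomial.X ^ (j % n) := by
  have h : (Polynomial.X ^ n + 1 : Polynomial (ZMod 2)) = Polynomial.X ^ n - 1 :=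
    (CharTwo.sub_eq_add _ _).symm
  have h' : (Polynomial.X ^ j - Polynomial.X ^ (j % n) : Polynomial (ZMod 2)) =
      ((Polynomial.X ^ n) ^ (j / n) - 1) * Polynomial.X ^ (j % n) := by
    rw [sub_mul, one_mul, ← pow_mul, ← pow_add, Nat.div_add_mod]
  rw [h, h']
  exact (sub_one_dvd_pow_sub_one _ _).mul_right _

theorem sum_Icc_ite_dvd_mul_X_pow {n : ℕ} (hn : 0 < n) (j : ℕ) (a : ZMod 2) :
    (∑ i ∈ Finset.Icc 1 n, Polynomial.C (if n ∣ i + j then a else 0) * Polynomial.X ^ (n - i)) =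
      Polynomial.C a * Polynomial.X ^ (j % n) := by
  have hj := Nat.mod_lt j hn
  rw [Finset.sum_eq_single (n - j % n)]
  · have hd : n ∣ n - j % n + j := by
      refine ⟨1 + j / n, ?_⟩
      have := Nat.div_add_mod j n
      rw [mul_add, mul_one]
      omega
    rw [if_pos hd, Nat.sub_sub_self hj.le]
  · intro i hi hne
    rw [Finset.mem_Icc] at hi
    rw [if_neg, map_zero, zero_mul]
    intro hd
    have hd' : n ∣ i + j % n := by
      rw [Nat.dvd_iff_mod_eq_zero] at hd ⊢
      simpa using hd
    obtain ⟨c, hc⟩ := hd'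
    have hc1 : c = 1 := by
      have h0 : 0 < c := Nat.pos_of_ne_zero (by rintro rfl; omega)
      have h2 : c < 2 := by
        by_contra! h
        have := Nat.mul_le_mul_left n h
        omega
      omega
    subst hc1
    omega
  · intro h
    exact absurd (Finset.mem_Icc.mpr ⟨by omega, by omega⟩) h

/-- Write `Q · U^(2^k) = ∑_{i ≥ -deg Q} b_i x^{-i}`. Then `b_i = b_j` whenever
`i ≡ j (mod 2^k)` for `i, j ≥ 0`, and
`Q ≡ b_1 x^(2^k - 1) + b_2 x^(2^k - 2) + ⋯ + b_{2^k} (mod x^(2^k) + 1)`. -/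
theorem polyMulU_coeff_periodic (k : ℕ) (hk : 1 ≤ k) (Q : Polynomial (ZMod 2)) :
    (∀ i j : ℕ, i % 2 ^ k = j % 2 ^ k →
      (polyToLaurent Q * Useries ^ 2 ^ k).coeff (i : ℤ) =
        (polyToLaurent Q * Useries ^ 2 ^ k).coeff (j : ℤ)) ∧
    (Polynomial.X ^ 2 ^ k + 1 : Polynomial (ZMod 2)) ∣
      (Q - ∑ i ∈ Finset.Icc (1 : ℕ) (2 ^ k),
        Polynomial.C ((polyToLaurent Q * Useries ^ 2 ^ k).coeff (i : ℤ)) *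
          Polynomial.X ^ (2 ^ k - i)) := by
  constructor
  · intro i j hij
    induction Q using Polynomial.induction_on' with
    | add P R hP hR => rw [coeff_polyToLaurent_add_mul, coeff_polyToLaurent_add_mul, hP, hR]
    | monomial m a =>
      have h : 2 ^ k ∣ i + m ↔ 2 ^ k ∣ j + m :=
        Nat.ModEq.dvd_iff (Nat.ModEq.add_right m hij) dvd_rfl
      simp only [coeff_polyToLaurent_monomial_mul, h]
  · induction Q using Polynomial.induction_on' with
    | add P R hP hR =>
      simp only [coeff_polyToLaurent_add_mul, map_add, add_mul, Finset.sum_add_distrib]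
      rw [add_sub_add_comm]
      exact dvd_add hP hR
    | monomial m a =>
      simp only [coeff_polyToLaurent_monomial_mul]
      rw [sum_Icc_ite_dvd_mul_X_pow (Nat.two_pow_pos k), ← Polynomial.C_mul_X_pow_eq_monomial,
        ← mul_sub]
      exact (X_pow_add_one_dvd_X_pow_sub_X_pow_mod _ _).mul_left _
end
end

section
/- Let k ≥ 1 and let (r_n) be the all-one pattern sequence over F_2 (p = 2, a = 2^k − 1). Let R = Σ_{i≥1} r_{i−1} x^{-i} ∈ F_2((x^{-1})). Then (1+x)·R^2 + R + U^{2^k}·x^{-2^k} = 0, where U = Σ_{i≥0} x^{-i}. -/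
noncomputable section

/-- Raising a power series over `ZMod p` to the power `p ^ k` spreads its coefficients out to the
multiples of `p ^ k`. -/
theorem PowerSeries.coeff_pow_char_pow_zmod (p : ℕ) [Fact p.Prime] (f : PowerSeries (ZMod p))
    (k n : ℕ) :
    PowerSeries.coeff n (f ^ p ^ k) =
      if p ^ k ∣ n then PowerSeries.coeff (n / p ^ k) f else 0 := by
  have hp : p ≠ 0 := (Fact.out : p.Prime).ne_zero
  have hid : iterateFrobenius (ZMod p) p k = RingHom.id (ZMod p) := Subsingleton.elim _ _
  have h : PowerSeries.expand (p ^ k) (pow_ne_zero k hp) f = f ^ p ^ k := by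
    have h := MvPowerSeries.map_iterateFrobenius_expand p hp f k
    rwa [hid, MvPowerSeries.map_id] at h
  rw [← h, PowerSeries.coeff_expand]

/-- The functional equation over `ZMod 2` of the generating series of a sequence counting
occurrences of the pattern `11⋯1` of length `k`. -/
theorem allOnePattern_mk_eq (k : ℕ) (hk : 1 ≤ k) (r : ℕ → ZMod 2) (hr0 : r 0 = 0)
    (hrec : ∀ n, 1 ≤ n → r n = r (n / 2) + if n % 2 ^ k = 2 ^ k - 1 then 1 else 0) :
    PowerSeries.mk r = PowerSeries.mk r ^ 2 + PowerSeries.X * PowerSeries.mk r ^ 2 +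
      PowerSeries.X ^ (2 ^ k - 1) * (PowerSeries.mk fun _ => (1 : ZMod 2)) ^ 2 ^ k := by
  have hN : 2 ≤ 2 ^ k := le_self_pow₀ one_le_two (by omega)
  have hsq (n : ℕ) : PowerSeries.coeff n (PowerSeries.mk r ^ 2) =
      if 2 ∣ n then r (n / 2) else 0 := by
    simpa using PowerSeries.coeff_pow_char_pow_zmod 2 (PowerSeries.mk r) 1 n
  have hsplit (n : ℕ) : PowerSeries.coeff n
      (PowerSeries.mk r ^ 2 + PowerSeries.X * PowerSeries.mk r ^ 2) = r (n / 2) := by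
    rcases n with _ | n
    · simp [hr0]
    · rw [map_add, PowerSeries.coeff_succ_X_mul, hsq, hsq]
      by_cases h : 2 ∣ n
      · rw [if_neg (by omega), if_pos h, zero_add, show (n + 1) / 2 = n / 2 by omega]
      · rw [if_pos (by omega), if_neg h, add_zero]
  have hind (n : ℕ) : PowerSeries.coeff n
      (PowerSeries.X ^ (2 ^ k - 1) * (PowerSeries.mk fun _ => (1 : ZMod 2)) ^ 2 ^ k) =
      if n % 2 ^ k = 2 ^ k - 1 then 1 else 0 := by
    rw [PowerSeries.coeff_X_pow_mul', PowerSeries.coeff_pow_char_pow_zmod, PowerSeries.coeff_mk,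
      ← ite_and]
    refine if_congr ?_ rfl rfl
    generalize 2 ^ k = N at hN
    constructor
    · rintro ⟨hle, c, hc⟩
      rw [show n = N - 1 + N * c by omega, Nat.add_mul_mod_self_left, Nat.mod_eq_of_lt (by omega)]
    · intro h
      have hdiv := Nat.mod_add_div n N
      exact ⟨h ▸ Nat.mod_le n N, n / N, by omega⟩
  ext n
  rw [map_add, hsplit, hind, PowerSeries.coeff_mk]
  rcases n with _ | n
  · rw [Nat.zero_div, Nat.zero_mod, if_neg (by omega), add_zero]
  · exact hrec (n + 1) n.succ_pos

/-- For the all-one pattern sequence `r` (pattern `11⋯1` of length `k`), the Laurent series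
`R = ∑_{i ≥ 1} r_{i-1} x^{-i}` satisfies `(1+x) R² + R + U^(2^k) x^{-2^k} = 0`. -/
theorem allOnePattern_laurent_equation (k : ℕ) (hk : 1 ≤ k)
    (r : ℕ → ZMod 2) (hr0 : r 0 = 0)
    (hrec : ∀ n, 1 ≤ n → r n = r (n / 2) + if n % 2 ^ k = 2 ^ k - 1 then 1 else 0)
    (R : LaurentSeries (ZMod 2))
    (hR : R = ((PowerSeries.X * PowerSeries.mk r : PowerSeries (ZMod 2)) :
      LaurentSeries (ZMod 2))) :
    (1 + xVar) * R ^ 2 + R + Useries ^ 2 ^ k * (xVar ^ 2 ^ k)⁻¹ = 0 := by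
  have hN : 2 ^ k - 1 + 1 = 2 ^ k := Nat.sub_add_cancel Nat.one_le_two_pow
  have hX : ((PowerSeries.X : PowerSeries (ZMod 2)) : LaurentSeries (ZMod 2)) ≠ 0 := by
    simp
  have hF := congrArg (HahnSeries.ofPowerSeries ℤ (ZMod 2)) (allOnePattern_mk_eq k hk r hr0 hrec)
  have hchar : (2 : LaurentSeries (ZMod 2)) = 0 := by
    rw [← map_ofNat (HahnSeries.C : ZMod 2 →+* LaurentSeries (ZMod 2)) 2,
      show (OfNat.ofNat 2 : ZMod 2) = 0 from rfl, map_zero]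
  simp only [map_add, map_mul, map_pow] at hF
  rw [hR, map_mul, xVar, Useries, inv_pow, inv_inv]
  generalize HahnSeries.ofPowerSeries ℤ (ZMod 2) PowerSeries.X = t at hF hX ⊢
  generalize HahnSeries.ofPowerSeries ℤ (ZMod 2) (PowerSeries.mk r) = F at hF ⊢
  generalize HahnSeries.ofPowerSeries ℤ (ZMod 2) (PowerSeries.mk fun _ => 1) ^ 2 ^ k = V at hF ⊢
  have hinv : t⁻¹ * t = 1 := inv_mul_cancel₀ hX
  rw [← hN, pow_succ]
  linear_combination t * F ^ 2 * hinv + -t * hF + t * F * hchar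
end
end
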